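/- arXiv:1410.0417 — 4 statements merged into one kernel-verified Lean document; each statement's English description precedes it below -/
import Mathlib

section
/- K-Bianchi circles intersect only at K-points: if C and C′ are K-Bianchi circles with C ≠ C′ (as subsets of ℂ ∪ {∞}) and z ∈ C ∩ C′ ∩ ℂ, then z lies in the image of K under the fixed embedding K ↪ ℂ. -/
open Complex ComplexConjugate NumberField OnePoint

/-- The finite part of the Möbius image of the extended real line `ℝ̂` under the matrix
`[[α,γ],[β,δ]]`: the set `{(αx+γ)/(βx+δ) : x ∈ ℝ, βx+δ ≠ 0} ∪ {α/β if β ≠ 0}`. -/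
def mobiusFin (α β γ δ : ℂ) : Set ℂ :=
  {z | (∃ x : ℝ, β * (x : ℂ) + δ ≠ 0 ∧ z = (α * x + γ) / (β * x + δ)) ∨ (β ≠ 0 ∧ z = α / β)}

/-- The Möbius image of `ℝ̂ = ℝ ∪ {∞}` in `ℂ ∪ {∞}` under the matrix `[[α,γ],[β,δ]]`;
`∞` belongs to it iff `β = 0` or `δ/β ∈ ℝ`. -/
def mobius (α β γ δ : ℂ) : Set (OnePoint ℂ) :=
  {w | (∃ z ∈ mobiusFin α β γ δ, w = (z : OnePoint ℂ)) ∨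
       ((β = 0 ∨ ∃ x : ℝ, δ = β * (x : ℂ)) ∧ w = ∞)}

/-- The extended real line `ℝ̂ = ℝ ∪ {∞}` as a subset of `ℂ ∪ {∞}`. -/
def rhat : Set (OnePoint ℂ) :=
  {w | (∃ x : ℝ, w = ((x : ℂ) : OnePoint ℂ)) ∨ w = ∞}

/-- The embedding of the ring of integers of `K` into `ℂ` induced by `ι : K →+* ℂ`. -/
noncomputable def emb (K : Type) [Field K] [NumberField K] (ι : K →+* ℂ)
    (x : RingOfIntegers K) : ℂ := ι (algebraMap (RingOfIntegers K) K x)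

/-- The `K`-Bianchi circle attached to `M ∈ SL₂(O_K)`: the Möbius image `M(ℝ̂) ⊆ ℂ ∪ {∞}`. -/
noncomputable def bianchiCircle (K : Type) [Field K] [NumberField K] (ι : K →+* ℂ)
    (M : Matrix.SpecialLinearGroup (Fin 2) (RingOfIntegers K)) : Set (OnePoint ℂ) :=
  mobius (emb K ι (M.1 0 0)) (emb K ι (M.1 1 0)) (emb K ι (M.1 0 1)) (emb K ι (M.1 1 1))

/-- A finite point lies on `mobius α β γ δ` iff it is the image of a real projective point. -/
theorem coe_mem_mobius_iff {α β γ δ : ℂ} (z : ℂ) :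
    (z : OnePoint ℂ) ∈ mobius α β γ δ ↔
      ∃ u v : ℝ, β * u + δ * v ≠ 0 ∧ α * u + γ * v = z * (β * u + δ * v) := by
  constructor
  · rintro (⟨w, hw, hzw⟩ | ⟨-, h⟩)
    · obtain rfl : z = w := OnePoint.coe_injective hzw
      rcases hw with ⟨x, hx, rfl⟩ | ⟨hβ, rfl⟩
      · refine ⟨x, 1, by simpa using hx, ?_⟩
        simp only [ofReal_one, mul_one]
        exact (div_mul_cancel₀ _ hx).symm
      · refine ⟨1, 0, by simpa using hβ, ?_⟩
        field_simp
        simp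
    · exact absurd h (OnePoint.coe_ne_infty z)
  · rintro ⟨u, v, hne, h⟩
    refine Or.inl ⟨z, ?_, rfl⟩
    by_cases hv : v = 0
    · subst hv
      simp only [ofReal_zero, mul_zero, add_zero] at hne h
      have hβ := left_ne_zero_of_mul hne
      have hu := right_ne_zero_of_mul hne
      refine Or.inr ⟨hβ, ?_⟩
      rw [eq_div_iff hβ]
      exact mul_right_cancel₀ hu (by linear_combination -h)
    · have hv' : (v : ℂ) ≠ 0 := ofReal_ne_zero.mpr hv
      have hne' : β * ((u / v : ℝ) : ℂ) + δ ≠ 0 := by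
        intro h0
        apply hne
        push_cast at h0
        field_simp at h0
        linear_combination h0
      refine Or.inl ⟨u / v, hne', ?_⟩
      rw [eq_div_iff hne']
      push_cast
      field_simp
      linear_combination -h

theorem infty_mem_mobius_iff {α β γ δ : ℂ} :
    (∞ : OnePoint ℂ) ∈ mobius α β γ δ ↔ ∃ u v : ℝ, (u ≠ 0 ∨ v ≠ 0) ∧ β * u + δ * v = 0 := by
  constructor
  · rintro (⟨w, -, hw⟩ | ⟨rfl | ⟨x, rfl⟩, -⟩)
    · exact absurd hw (OnePoint.infty_ne_coe w)
    · exact ⟨1, 0, by simp, by simp⟩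
    · exact ⟨-x, 1, by simp, by simp⟩
  · rintro ⟨u, v, huv, h⟩
    refine Or.inr ⟨?_, rfl⟩
    by_cases hv : v = 0
    · subst hv
      have hu : (u : ℂ) ≠ 0 := ofReal_ne_zero.mpr (by simpa using huv)
      exact Or.inl ((mul_eq_zero.mp (by simpa using h)).resolve_right hu)
    · have hv' : (v : ℂ) ≠ 0 := ofReal_ne_zero.mpr hv
      refine Or.inr ⟨-u / v, ?_⟩
      push_cast
      field_simp
      linear_combination h

/-- A matrix proportional to a real one only reparametrises the circle. -/
theorem mobius_subset_of_real_mul {α β γ δ α' β' γ' δ' l : ℂ} {p q r s : ℝ}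
    (hl : l ≠ 0) (hpq : p * s - q * r ≠ 0)
    (hα : α = l * (α' * p + γ' * q)) (hγ : γ = l * (α' * r + γ' * s))
    (hβ : β = l * (β' * p + δ' * q)) (hδ : δ = l * (β' * r + δ' * s)) :
    mobius α β γ δ ⊆ mobius α' β' γ' δ' := by
  have top : ∀ u v : ℝ, α * u + γ * v =
      l * (α' * ((p * u + r * v : ℝ) : ℂ) + γ' * ((q * u + s * v : ℝ) : ℂ)) := by
    intro u v
    rw [hα, hγ]
    push_cast
    ring
  have bot : ∀ u v : ℝ, β * u + δ * v =
      l * (β' * ((p * u + r * v : ℝ) : ℂ) + δ' * ((q * u + s * v : ℝ) : ℂ)) := by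
    intro u v
    rw [hβ, hδ]
    push_cast
    ring
  intro w
  induction w using OnePoint.rec with
  | infty =>
    rw [infty_mem_mobius_iff, infty_mem_mobius_iff]
    rintro ⟨u, v, huv, h⟩
    refine ⟨p * u + r * v, q * u + s * v, ?_, ?_⟩
    · by_contra! h0
      obtain ⟨h1, h2⟩ := h0
      have hu : (p * s - q * r) * u = 0 := by linear_combination s * h1 - r * h2
      have hv : (p * s - q * r) * v = 0 := by linear_combination p * h2 - q * h1
      rcases huv with h | h
      · exact (mul_ne_zero hpq h) hu
      · exact (mul_ne_zero hpq h) hv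
    · rw [bot] at h
      exact (mul_eq_zero.mp h).resolve_left hl
  | coe z =>
    rw [coe_mem_mobius_iff, coe_mem_mobius_iff]
    rintro ⟨u, v, hne, h⟩
    refine ⟨p * u + r * v, q * u + s * v, ?_, ?_⟩
    · rw [bot] at hne
      exact right_ne_zero_of_mul hne
    · rw [bot, top] at h
      exact mul_left_cancel₀ hl (by linear_combination h)

/-- Two circles agree if the transition matrix `[[a,c],[b,d]]` satisfies `N̄ = e N`. -/
theorem mobius_subset_of_conj_eq {α β γ δ α' β' γ' δ' a b c d e : ℂ}
    (hN : a * d - b * c = 1)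
    (hα : α = α' * a + γ' * b) (hγ : γ = α' * c + γ' * d)
    (hβ : β = β' * a + δ' * b) (hδ : δ = β' * c + δ' * d)
    (ha : conj a = e * a) (hb : conj b = e * b) (hc : conj c = e * c) (hd : conj d = e * d) :
    mobius α β γ δ ⊆ mobius α' β' γ' δ' := by
  have he : e * e = 1 := by
    have h := congrArg conj hN
    simp only [map_sub, map_mul, map_one, ha, hb, hc, hd] at h
    linear_combination h - e * e * hN
  obtain ⟨l, hl, hreal⟩ : ∃ l : ℂ, l ≠ 0 ∧
      ∀ x : ℂ, conj x = e * x → ∃ y : ℝ, x = l * y := by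
    rcases mul_self_eq_one_iff.mp he with rfl | rfl
    · refine ⟨1, one_ne_zero, fun x hx => ?_⟩
      obtain ⟨y, hy⟩ := conj_eq_iff_real.mp (by simpa using hx)
      exact ⟨y, by simpa using hy⟩
    · refine ⟨I, I_ne_zero, fun x hx => ⟨x.im, ?_⟩⟩
      have := congrArg re hx
      simp at this
      apply Complex.ext
      · simp; linarith
      · simp
  obtain ⟨p, rfl⟩ := hreal a ha
  obtain ⟨q, rfl⟩ := hreal b hb
  obtain ⟨r, rfl⟩ := hreal c hc
  obtain ⟨s, rfl⟩ := hreal d hd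
  refine mobius_subset_of_real_mul (p := p) (q := q) (r := r) (s := s) hl ?_
    (by rw [hα]; ring) (by rw [hγ]; ring) (by rw [hβ]; ring) (by rw [hδ]; ring)
  intro h0
  have hzero : (p : ℂ) * s - q * r = 0 := by exact_mod_cast h0
  exact one_ne_zero (α := ℂ) (by linear_combination -hN + l * l * hzero)

/-- A matrix of determinant one preserving `ℝ̂` satisfies `N̄ = e N`. -/
theorem conj_eq_mul_of_hermitian_eq_zero {a b c d : ℂ} (hN : a * d - b * c = 1)
    (h₁ : a * conj b = conj a * b) (h₂ : c * conj d = conj c * d)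
    (h₃ : a * conj d + c * conj b = conj a * d + conj c * b) :
    ∃ e : ℂ, conj a = e * a ∧ conj b = e * b ∧ conj c = e * c ∧ conj d = e * d := by
  refine ⟨conj a * d - conj b * c, ?_, ?_, ?_, ?_⟩
  · linear_combination -conj a * hN + c * h₁
  · linear_combination -conj b * hN + d * h₁
  · linear_combination -conj c * hN - a * h₂ + c * h₃
  · linear_combination -conj d * hN - b * h₂ + d * h₃

theorem mobius_eq_of_hermitian_eq_zero {α β γ δ α' β' γ' δ' a b c d : ℂ}
    (hN : a * d - b * c = 1)
    (hα : α = α' * a + γ' * b) (hγ : γ = α' * c + γ' * d)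
    (hβ : β = β' * a + δ' * b) (hδ : δ = β' * c + δ' * d)
    (h₁ : a * conj b = conj a * b) (h₂ : c * conj d = conj c * d)
    (h₃ : a * conj d + c * conj b = conj a * d + conj c * b) :
    mobius α β γ δ = mobius α' β' γ' δ' := by
  obtain ⟨e, ha, hb, hc, hd⟩ := conj_eq_mul_of_hermitian_eq_zero hN h₁ h₂ h₃
  refine (mobius_subset_of_conj_eq hN hα hγ hβ hδ ha hb hc hd).antisymm
    (mobius_subset_of_conj_eq (a := d) (b := -b) (c := -c) (d := a) (e := e) ?_
      ?_ ?_ ?_ ?_ hd ?_ ?_ ha)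
  · linear_combination hN
  · rw [hα, hγ]; linear_combination -α' * hN
  · rw [hα, hγ]; linear_combination -γ' * hN
  · rw [hβ, hδ]; linear_combination -β' * hN
  · rw [hβ, hδ]; linear_combination -δ' * hN
  · rw [map_neg, hb]; ring
  · rw [map_neg, hc]; ring

/-- The differences `a - ā` of an imaginary quadratic ring form a cyclic group. -/
theorem exists_sub_conj_eq_intCast_mul (O : Subring ℂ) (hconj : ∀ a ∈ O, conj a ∈ O)
    (hrat : ∀ a ∈ O, conj a = a → ∃ n : ℤ, a = n) :
    ∃ w ∈ O, ∀ a ∈ O, ∃ n : ℤ, a - conj a = n * (w - conj w) := by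
  by_cases hreal : ∀ a ∈ O, conj a = a
  · exact ⟨0, O.zero_mem, fun a ha => ⟨0, by simp [hreal a ha]⟩⟩
  push Not at hreal
  obtain ⟨x, hx, hne⟩ := hreal
  have hs : x - conj x ≠ 0 := sub_ne_zero.mpr (Ne.symm hne)
  let H : AddSubgroup ℤ :=
    { carrier := {n | ∃ a ∈ O, (a - conj a) * (x - conj x) = n}
      zero_mem' := ⟨0, O.zero_mem, by simp⟩
      add_mem' := by
        rintro m n ⟨a, ha, hm⟩ ⟨b, hb, hn⟩
        refine ⟨a + b, O.add_mem ha hb, ?_⟩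
        push_cast
        rw [map_add, ← hm, ← hn]
        ring
      neg_mem' := by
        rintro m ⟨a, ha, hm⟩
        refine ⟨-a, O.neg_mem ha, ?_⟩
        push_cast
        rw [map_neg, ← hm]
        ring }
  obtain ⟨g, hg⟩ := Int.subgroup_cyclic H
  have hgH : g ∈ H := hg ▸ AddSubgroup.subset_closure rfl
  obtain ⟨w, hw, hwg⟩ := hgH
  refine ⟨w, hw, fun a ha => ?_⟩
  obtain ⟨m, hm⟩ := hrat ((a - conj a) * (x - conj x))
    (O.mul_mem (O.sub_mem ha (hconj a ha)) (O.sub_mem hx (hconj x hx)))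
    (by simp only [map_mul, map_sub, conj_conj]; ring)
  have hmH : m ∈ H := ⟨a, ha, hm⟩
  rw [hg, AddSubgroup.mem_closure_singleton] at hmH
  obtain ⟨k, hk⟩ := hmH
  refine ⟨k, mul_right_cancel₀ hs ?_⟩
  rw [hm, ← hk, mul_assoc, hwg]
  simp

/-- A real zero of a nonzero binary integral quadratic form with discriminant `n`, where
`D * n = t ^ 2 - 4` for a negative quadratic discriminant `D`, is rational. -/
theorem exists_int_proportional_of_quadratic_eq_zero {p q r D t : ℤ} (hD : D < 0)
    (hD4 : D % 4 = 0 ∨ D % 4 = 1) (hn : D * (q ^ 2 - 4 * p * r) = t ^ 2 - 4)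
    (hne : ¬ (p = 0 ∧ q = 0 ∧ r = 0)) {u v : ℝ} (huv : u ≠ 0 ∨ v ≠ 0)
    (h : p * u ^ 2 + q * (u * v) + r * v ^ 2 = 0) :
    ∃ m n : ℤ, (m ≠ 0 ∨ n ≠ 0) ∧ u * n = v * m := by
  by_cases hp : p = 0
  · subst hp
    by_cases hv : v = 0
    · exact ⟨1, 0, by simp, by simp [hv]⟩
    · refine ⟨-r, q, by omega, mul_right_cancel₀ hv ?_⟩
      push_cast at h ⊢
      linear_combination h
  have hp' : (p : ℝ) ≠ 0 := by exact_mod_cast hp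
  have hv : v ≠ 0 := by
    rintro rfl
    have : (p : ℝ) * u ^ 2 = 0 := by linear_combination h
    simp_all
  have hsq : (2 * p * u + q * v) ^ 2 = ((q ^ 2 - 4 * p * r : ℤ) : ℝ) * v ^ 2 := by
    push_cast
    linear_combination 4 * p * h
  have hn0 : 0 ≤ q ^ 2 - 4 * p * r := by
    have : (0 : ℝ) ≤ ((q ^ 2 - 4 * p * r : ℤ) : ℝ) := by
      by_contra! hlt
      have := mul_neg_of_neg_of_pos hlt (sq_pos_of_ne_zero hv)
      nlinarith [sq_nonneg (2 * p * u + q * v)]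
    exact_mod_cast this
  obtain ⟨k, hk⟩ : ∃ k : ℤ, q ^ 2 - 4 * p * r = k ^ 2 := by
    generalize q ^ 2 - 4 * p * r = n at hn hn0
    have ht : -2 ≤ t ∧ t ≤ 2 := by constructor <;> nlinarith
    rcases hn0.eq_or_lt with rfl | hpos
    · exact ⟨0, rfl⟩
    refine ⟨1, ?_⟩
    have hD3 : D ≤ -3 := by omega
    have : n < 2 := by nlinarith
    omega
  rw [hk] at hsq
  push_cast at hsq
  rw [← mul_pow, sq_eq_sq_iff_eq_or_eq_neg] at hsq
  rcases hsq with hsq | hsq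
  · exact ⟨k - q, 2 * p, by omega, by push_cast; linear_combination hsq⟩
  · exact ⟨-k - q, 2 * p, by omega, by push_cast; linear_combination hsq⟩

/-- A real point mapped to a real point by a determinant-one matrix over an imaginary quadratic
ring that does not preserve `ℝ̂` is rational. -/
theorem exists_int_proportional_of_subring (O : Subring ℂ) (hconj : ∀ a ∈ O, conj a ∈ O)
    (hrat : ∀ a ∈ O, conj a = a → ∃ n : ℤ, a = n) {a b c d : ℂ}
    (ha : a ∈ O) (hb : b ∈ O) (hc : c ∈ O) (hd : d ∈ O) (hN : a * d - b * c = 1)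
    (hne : ¬ (a * conj b = conj a * b ∧ c * conj d = conj c * d ∧
      a * conj d + c * conj b = conj a * d + conj c * b))
    {u v : ℝ} (huv : u ≠ 0 ∨ v ≠ 0)
    (h : (a * u + c * v) * conj (b * u + d * v) = conj (a * u + c * v) * (b * u + d * v)) :
    ∃ m n : ℤ, (m ≠ 0 ∨ n ≠ 0) ∧ u * n = v * m := by
  obtain ⟨w, hw, hgen⟩ := exists_sub_conj_eq_intCast_mul O hconj hrat
  obtain ⟨p, hp⟩ := hgen (a * conj b) (O.mul_mem ha (hconj b hb))
  obtain ⟨r, hr⟩ := hgen (c * conj d) (O.mul_mem hc (hconj d hd))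
  obtain ⟨q, hq⟩ := hgen (a * conj d + c * conj b)
    (O.add_mem (O.mul_mem ha (hconj d hd)) (O.mul_mem hc (hconj b hb)))
  simp only [map_mul, map_add, conj_conj] at hp hr hq h
  simp only [conj_ofReal] at h
  have hs : w - conj w ≠ 0 := by
    intro hs
    rw [hs, mul_zero] at hp hq hr
    exact hne ⟨sub_eq_zero.mp hp, sub_eq_zero.mp hr, sub_eq_zero.mp hq⟩
  obtain ⟨T, hT⟩ := hrat (w + conj w) (O.add_mem hw (hconj w hw))
    (by simp only [map_add, conj_conj]; ring)
  obtain ⟨n, hn⟩ := hrat (w * conj w) (O.mul_mem hw (hconj w hw))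
    (by simp only [map_mul, conj_conj]; ring)
  obtain ⟨t, ht⟩ := hrat (conj a * d - conj b * c + (a * conj d - b * conj c))
    (O.add_mem
      (O.sub_mem (O.mul_mem (hconj a ha) hd) (O.mul_mem (hconj b hb) hc))
      (O.sub_mem (O.mul_mem ha (hconj d hd)) (O.mul_mem hb (hconj c hc))))
    (by simp only [map_mul, map_add, map_sub, conj_conj]; ring)
  have hD : (w - conj w) ^ 2 = ((T ^ 2 - 4 * n : ℤ) : ℂ) := by
    push_cast
    rw [← hT, ← hn]
    ring
  have hDneg : T ^ 2 - 4 * n < 0 := by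
    have him : w.im ≠ 0 := by
      intro h0
      exact hs (sub_eq_zero.mpr (conj_eq_iff_im.mpr h0).symm)
    have hre : ((T ^ 2 - 4 * n : ℤ) : ℝ) = -(2 * w.im) ^ 2 := by
      have := congrArg re hD
      rw [intCast_re] at this
      rw [← this, sub_conj]
      simp [pow_two]
    have : ((T ^ 2 - 4 * n : ℤ) : ℝ) < 0 := by
      rw [hre]
      have : 0 < (2 * w.im) ^ 2 := by positivity
      linarith
    exact_mod_cast this
  have hdetconj : conj a * conj d - conj b * conj c = 1 := by
    simpa using congrArg conj hN
  refine exists_int_proportional_of_quadratic_eq_zero (p := p) (q := q) (r := r)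
    (D := T ^ 2 - 4 * n) (t := t) hDneg ?_ ?_ ?_ huv ?_
  · rcases Int.even_or_odd' T with ⟨k, rfl | rfl⟩
    · left; ring_nf; omega
    · right; ring_nf; omega
  · have : (((T ^ 2 - 4 * n) * (q ^ 2 - 4 * p * r) : ℤ) : ℂ) = ((t ^ 2 - 4 : ℤ) : ℂ) := by
      rw [Int.cast_mul, ← hD]
      push_cast
      rw [← ht]
      have e : (w - conj w) ^ 2 * ((q : ℂ) ^ 2 - 4 * p * r) =
          (q * (w - conj w)) ^ 2 - 4 * (p * (w - conj w)) * (r * (w - conj w)) := by ring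
      rw [e, ← hp, ← hq, ← hr]
      linear_combination (-4 * (conj a * conj d - conj b * conj c)) * hN - 4 * hdetconj
    exact_mod_cast this
  · rintro ⟨rfl, rfl, rfl⟩
    simp only [Int.cast_zero, zero_mul] at hp hq hr
    exact hne ⟨sub_eq_zero.mp hp, sub_eq_zero.mp hr, sub_eq_zero.mp hq⟩
  · have : (p : ℂ) * u ^ 2 + q * (u * v) + r * v ^ 2 = 0 := by
      apply mul_right_cancel₀ hs
      linear_combination h - (u : ℂ) ^ 2 * hp - (u : ℂ) * v * hq - (v : ℂ) ^ 2 * hr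
    exact_mod_cast this

/-- Distinct circles with entries in an imaginary quadratic ring meet in rational parameters. -/
theorem exists_int_param_of_mem_mobius (O : Subring ℂ) (hconj : ∀ a ∈ O, conj a ∈ O)
    (hrat : ∀ a ∈ O, conj a = a → ∃ n : ℤ, a = n) {α β γ δ α' β' γ' δ' z : ℂ}
    (hα : α ∈ O) (hβ : β ∈ O) (hγ : γ ∈ O) (hδ : δ ∈ O)
    (hα' : α' ∈ O) (hβ' : β' ∈ O) (hγ' : γ' ∈ O) (hδ' : δ' ∈ O)
    (hdet : α * δ - β * γ = 1) (hdet' : α' * δ' - β' * γ' = 1)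
    (hne : mobius α β γ δ ≠ mobius α' β' γ' δ')
    (hz : (z : OnePoint ℂ) ∈ mobius α β γ δ) (hz' : (z : OnePoint ℂ) ∈ mobius α' β' γ' δ') :
    ∃ m n : ℤ, z = (α * m + γ * n) / (β * m + δ * n) := by
  obtain ⟨u, v, hκ, huv⟩ := (coe_mem_mobius_iff z).mp hz
  obtain ⟨u', v', hκ', huv'⟩ := (coe_mem_mobius_iff z).mp hz'
  have huv0 : u ≠ 0 ∨ v ≠ 0 := by
    by_contra! h0
    simp [h0.1, h0.2] at hκ
  set κ := β * u + δ * v with hκdef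
  set κ' := β' * u' + δ' * v' with hκdef'
  have hN : (δ' * α - γ' * β) * (α' * δ - β' * γ) - (α' * β - β' * α) * (δ' * γ - γ' * δ) = 1 := by
    linear_combination (α * δ - β * γ) * hdet' + hdet
  have hX : ((δ' * α - γ' * β) * u + (δ' * γ - γ' * δ) * v) * κ' = κ * u' := by
    linear_combination δ' * κ' * huv - δ' * κ * huv' + κ * u' * hdet' + γ' * κ' * hκdef
      - γ' * κ * hκdef'
  have hY : ((α' * β - β' * α) * u + (α' * δ - β' * γ) * v) * κ' = κ * v' := by
    linear_combination -β' * κ' * huv + β' * κ * huv' + κ * v' * hdet' - α' * κ' * hκdef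
      + α' * κ * hκdef'
  obtain ⟨m, n, hmn, hprop⟩ := exists_int_proportional_of_subring O hconj hrat
    (a := δ' * α - γ' * β) (b := α' * β - β' * α) (c := δ' * γ - γ' * δ) (d := α' * δ - β' * γ)
    (O.sub_mem (O.mul_mem hδ' hα) (O.mul_mem hγ' hβ))
    (O.sub_mem (O.mul_mem hα' hβ) (O.mul_mem hβ' hα))
    (O.sub_mem (O.mul_mem hδ' hγ) (O.mul_mem hγ' hδ))
    (O.sub_mem (O.mul_mem hα' hδ) (O.mul_mem hβ' hγ)) hN
    (fun ⟨h₁, h₂, h₃⟩ => hne (mobius_eq_of_hermitian_eq_zero hN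
      (by linear_combination -α * hdet') (by linear_combination -γ * hdet')
      (by linear_combination -β * hdet') (by linear_combination -δ * hdet') h₁ h₂ h₃))
    huv0 (by
      generalize (δ' * α - γ' * β) * u + (δ' * γ - γ' * δ) * v = X at hX
      generalize (α' * β - β' * α) * u + (α' * δ - β' * γ) * v = Y at hY
      have hXc := congrArg conj hX
      have hYc := congrArg conj hY
      simp only [map_mul, conj_ofReal] at hXc hYc
      have hc : conj κ' ≠ 0 := (map_ne_zero _).mpr hκ'
      apply mul_right_cancel₀ (mul_ne_zero hκ' hc)
      linear_combination conj Y * conj κ' * hX + κ * u' * hYc - Y * κ' * hXc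
        - conj κ * u' * hY)
  have hpropC : (u : ℂ) * n = v * m := by exact_mod_cast hprop
  obtain ⟨k, hk, hm, hn⟩ : ∃ k : ℂ, k ≠ 0 ∧ (m : ℂ) = k * u ∧ (n : ℂ) = k * v := by
    by_cases hu : u = 0
    · have hv : (v : ℂ) ≠ 0 := ofReal_ne_zero.mpr (by tauto)
      have hm : m = 0 := by
        have : (v : ℂ) * m = 0 := by rw [← hpropC, hu]; simp
        exact_mod_cast (mul_eq_zero.mp this).resolve_left hv
      have hn : (n : ℂ) ≠ 0 := by exact_mod_cast (by tauto : n ≠ 0)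
      exact ⟨n / v, div_ne_zero hn hv, by simp [hu, hm], by field_simp⟩
    · have hu' : (u : ℂ) ≠ 0 := ofReal_ne_zero.mpr hu
      have hm : (m : ℂ) ≠ 0 := by
        intro hm
        rw [hm, mul_zero] at hpropC
        have hn := (mul_eq_zero.mp hpropC).resolve_left hu'
        have hm0 : m = 0 := by exact_mod_cast hm
        have hn0 : n = 0 := by exact_mod_cast hn
        tauto
      exact ⟨m / u, div_ne_zero hm hu', by field_simp, by
        field_simp
        linear_combination hpropC⟩
  refine ⟨m, n, ?_⟩
  rw [hm, hn]
  have hbot : β * (k * u) + δ * (k * v) = k * κ := by rw [hκdef]; ring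
  rw [hbot, eq_div_iff (mul_ne_zero hk hκ)]
  linear_combination -k * huv

section ImaginaryQuadratic

variable {K : Type} [Field K] [NumberField K]

theorem not_isReal_of_discr_neg (hdeg : Module.finrank ℚ K = 2) (hdisc : discr K < 0)
    (ι : K →+* ℂ) : ¬ ComplexEmbedding.IsReal ι := by
  intro h
  have hsign := sign_discr K
  rw [Int.sign_eq_neg_one_of_neg hdisc] at hsign
  have hcard := InfinitePlace.card_add_two_mul_card_eq_rank K
  have hc : InfinitePlace.nrComplexPlaces K ≠ 0 := by
    intro h0
    rw [h0] at hsign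
    norm_num at hsign
  classical
  have hpos : 0 < InfinitePlace.nrRealPlaces K :=
    Fintype.card_pos_iff.mpr ⟨⟨InfinitePlace.mk ι, InfinitePlace.isReal_mk_iff.mpr h⟩⟩
  omega

/-- Algebraic integers of an imaginary quadratic field which are real are rational integers. -/
theorem exists_intCast_eq_emb_of_conj_eq (hdeg : Module.finrank ℚ K = 2) (ι : K →+* ℂ)
    (hι : ¬ ComplexEmbedding.IsReal ι) (x : 𝓞 K) (hx : conj (emb K ι x) = emb K ι x) :
    ∃ n : ℤ, emb K ι x = n := by
  have := Subalgebra.isSimpleOrder_of_finrank_prime ℚ K (hdeg ▸ Nat.prime_two)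
  let S := AlgHom.equalizer ((starRingEnd ℂ).comp ι).toRatAlgHom ι.toRatAlgHom
  have hbot : S = ⊥ := by
    refine (eq_bot_or_eq_top S).resolve_right fun htop => hι (RingHom.ext fun y => ?_)
    have hy : y ∈ S := htop ▸ Algebra.mem_top
    exact hy
  have hxS : (x : K) ∈ S := hx
  rw [hbot, Algebra.mem_bot] at hxS
  obtain ⟨q, hq⟩ := hxS
  have hqint : IsIntegral ℤ q := by
    rw [← isIntegral_algebraMap_iff (algebraMap ℚ K).injective, hq]
    exact RingOfIntegers.isIntegral_coe x
  obtain ⟨n, rfl⟩ := IsIntegrallyClosed.isIntegral_iff.mp hqint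
  refine ⟨n, ?_⟩
  change ι (x : K) = n
  rw [← hq]
  simp

/-- The integers of a quadratic field form a conjugation-stable subring of `ℂ`. -/
theorem exists_emb_eq_conj (hdeg : Module.finrank ℚ K = 2) (ι : K →+* ℂ) (x : 𝓞 K) :
    ∃ y : 𝓞 K, emb K ι y = conj (emb K ι x) := by
  by_cases hreal : conj (emb K ι x) = emb K ι x
  · exact ⟨x, hreal.symm⟩
  obtain ⟨s, t, hst⟩ : ∃ s t : ℤ, x ^ 2 + s • x + t • (1 : 𝓞 K) = 0 := by
    have hCH := Algebra.aeval_self_charpoly_lmul (R := ℤ) x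
    have hmonic := (Algebra.lmul ℤ (𝓞 K) x).charpoly_monic
    have hnat : (Algebra.lmul ℤ (𝓞 K) x).charpoly.natDegree = 2 := by
      rw [LinearMap.charpoly_natDegree, RingOfIntegers.rank, hdeg]
    rw [hmonic.as_sum, hnat] at hCH
    refine ⟨(Algebra.lmul ℤ (𝓞 K) x).charpoly.coeff 1,
      (Algebra.lmul ℤ (𝓞 K) x).charpoly.coeff 0, Eq.trans ?_ hCH⟩
    simp [Finset.sum_range_succ]
    ring
  have hz : emb K ι x ^ 2 + s * emb K ι x + t = 0 := by
    have := congrArg (ι.comp (algebraMap (𝓞 K) K)) hst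
    simpa [emb] using this
  have hzc := congrArg conj hz
  simp only [map_add, map_mul, map_pow, map_intCast, map_zero] at hzc
  refine ⟨-x - s, ?_⟩
  have he : emb K ι (-x - s) = -emb K ι x - s := by simp [emb]
  rw [he]
  apply mul_left_cancel₀ (sub_ne_zero.mpr hreal)
  linear_combination hz - hzc

theorem emb_det (ι : K →+* ℂ) (M : Matrix.SpecialLinearGroup (Fin 2) (𝓞 K)) :
    emb K ι (M.1 0 0) * emb K ι (M.1 1 1) - emb K ι (M.1 1 0) * emb K ι (M.1 0 1) = 1 := by
  have h := congrArg (ι.comp (algebraMap (𝓞 K) K)) M.2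
  rw [Matrix.det_fin_two, map_sub, map_mul, map_mul, map_one] at h
  rw [mul_comm (emb K ι (M.1 1 0))]
  exact h

end ImaginaryQuadratic

/-- `K`-Bianchi circles intersect only at `K`-points: if two distinct
`K`-Bianchi circles share a finite point `z ∈ ℂ`, then `z` lies in the image of `K`
under the fixed embedding. -/
theorem stmt4 (K : Type) [Field K] [NumberField K]
    (hdeg : Module.finrank ℚ K = 2) (hdisc : NumberField.discr K < 0)
    (ι : K →+* ℂ)
    (M M' : Matrix.SpecialLinearGroup (Fin 2) (RingOfIntegers K))
    (hne : bianchiCircle K ι M ≠ bianchiCircle K ι M')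
    (z : ℂ)
    (hz : (z : OnePoint ℂ) ∈ bianchiCircle K ι M ∩ bianchiCircle K ι M') :
    ∃ x : K, ι x = z := by
  let O : Subring ℂ := (ι.comp (algebraMap (𝓞 K) K)).range
  have hmem (x : 𝓞 K) : emb K ι x ∈ O := ⟨x, rfl⟩
  have hconj : ∀ a ∈ O, conj a ∈ O := by
    rintro _ ⟨x, rfl⟩
    exact exists_emb_eq_conj hdeg ι x
  have hrat : ∀ a ∈ O, conj a = a → ∃ n : ℤ, a = n := by
    rintro _ ⟨x, rfl⟩ hx
    exact exists_intCast_eq_emb_of_conj_eq hdeg ι (not_isReal_of_discr_neg hdeg hdisc ι) x hx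
  obtain ⟨m, n, hmn⟩ := exists_int_param_of_mem_mobius O hconj hrat
    (hmem _) (hmem _) (hmem _) (hmem _) (hmem _) (hmem _) (hmem _) (hmem _)
    (emb_det ι M) (emb_det ι M') hne hz.1 hz.2
  refine ⟨((M.1 0 0 : 𝓞 K) * m + (M.1 0 1 : 𝓞 K) * n) /
    ((M.1 1 0 : 𝓞 K) * m + (M.1 1 1 : 𝓞 K) * n), ?_⟩
  rw [hmn]
  simp [emb]
end

section
/- Let M = [[α,γ],[β,δ]] and M′ = [[α′,γ′],[β′,δ′]] be elements of SL₂(O_K). Then the following are equivalent: (i) there exist a unit ε ∈ O_K^× and η ∈ O_K such that the affine map z ↦ εz + η (extended to ℂ ∪ {∞} by sending ∞ to ∞) maps M(ℝ̂) onto M′(ℝ̂); (ii) there exists a unit u ∈ O_K^× such that ℤβ′ + ℤδ′ = u·(ℤβ + ℤδ). Thus two K-Bianchi circles are equivalent if and only if the lattices spanned by the bottom rows of defining matrices agree up to multiplication by a unit. -/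
open Complex ComplexConjugate NumberField OnePoint

/-- The affine map `z ↦ εz + η` on `ℂ`, extended to `ℂ ∪ {∞}` by sending `∞` to `∞`. -/
noncomputable def affExt (ε η : ℂ) : OnePoint ℂ → OnePoint ℂ :=
  OnePoint.map (fun z => ε * z + η)

/-- The point of `ℂ ∪ {∞}` with homogeneous coordinates `[p : q]`. -/
noncomputable def projPoint (p q : ℂ) : OnePoint ℂ :=
  open Classical in if q = 0 then ∞ else ((p / q : ℂ) : OnePoint ℂ)

theorem projPoint_zero (p : ℂ) : projPoint p 0 = ∞ := by simp [projPoint]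

theorem projPoint_of_ne {p q : ℂ} (hq : q ≠ 0) :
    projPoint p q = ((p / q : ℂ) : OnePoint ℂ) := by simp [projPoint, hq]

theorem projPoint_smul {k : ℂ} (hk : k ≠ 0) (p q : ℂ) :
    projPoint (k * p) (k * q) = projPoint p q := by
  by_cases hq : q = 0
  · simp [hq, projPoint_zero]
  · rw [projPoint_of_ne hq, projPoint_of_ne (mul_ne_zero hk hq), mul_div_mul_left _ _ hk]

theorem cross_mul_eq_of_projPoint_eq {p q p' q' : ℂ} (h : projPoint p q = projPoint p' q') :
    p * q' = p' * q := by
  by_cases hq : q = 0 <;> by_cases hq' : q' = 0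
  · simp [hq, hq']
  · rw [hq, projPoint_zero, projPoint_of_ne hq'] at h
    exact absurd h (infty_ne_coe _)
  · rw [hq', projPoint_zero, projPoint_of_ne hq] at h
    exact absurd h (coe_ne_infty _)
  · rw [projPoint_of_ne hq, projPoint_of_ne hq', OnePoint.coe_eq_coe, div_eq_div_iff hq hq'] at h
    exact h

theorem affExt_projPoint (ε η p q : ℂ) :
    affExt ε η (projPoint p q) = projPoint (ε * p + η * q) q := by
  by_cases hq : q = 0
  · simp [hq, projPoint_zero, affExt]
  · rw [projPoint_of_ne hq, projPoint_of_ne hq, affExt, OnePoint.map_some, OnePoint.coe_eq_coe]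
    field_simp

/-- The circle `M(ℝ̂)` in homogeneous coordinates. -/
theorem mem_mobius_iff {α β γ δ : ℂ} {w : OnePoint ℂ} :
    w ∈ mobius α β γ δ ↔
      ∃ x y : ℝ, (x ≠ 0 ∨ y ≠ 0) ∧ w = projPoint (α * x + γ * y) (β * x + δ * y) := by
  constructor
  · rintro (⟨z, ⟨x, hx, rfl⟩ | ⟨hβ, rfl⟩, rfl⟩ | ⟨hβ | ⟨x, hx⟩, rfl⟩)
    · exact ⟨x, 1, by simp, by simp [projPoint_of_ne hx]⟩
    · exact ⟨1, 0, by simp, by simp [projPoint_of_ne hβ]⟩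
    · exact ⟨1, 0, by simp, by simp [hβ, projPoint_zero]⟩
    · exact ⟨-x, 1, by simp, by simp [hx, projPoint_zero]⟩
  · rintro ⟨x, y, hxy, rfl⟩
    by_cases hy : y = 0
    · have hx : (x : ℂ) ≠ 0 := by simpa [hy] using hxy
      have key : projPoint (α * x + γ * y) (β * x + δ * y) = projPoint α β := by
        rw [← projPoint_smul hx α β, hy]
        simp [mul_comm]
      rw [key]
      by_cases hβ : β = 0
      · exact Or.inr ⟨Or.inl hβ, by rw [hβ, projPoint_zero]⟩
      · exact Or.inl ⟨_, Or.inr ⟨hβ, rfl⟩, projPoint_of_ne hβ⟩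
    · have hy' : (y : ℂ) ≠ 0 := by exact_mod_cast hy
      have key : projPoint (α * x + γ * y) (β * x + δ * y)
          = projPoint (α * (x / y : ℝ) + γ) (β * (x / y : ℝ) + δ) := by
        rw [← projPoint_smul hy' (α * (x / y : ℝ) + γ)]
        congr 1 <;> (push_cast; field_simp)
      rw [key]
      by_cases hq : β * (x / y : ℝ) + δ = 0
      · refine Or.inr ⟨Or.inr ⟨-(x / y), ?_⟩, by rw [hq, projPoint_zero]⟩
        push_cast at hq ⊢
        linear_combination hq
      · exact Or.inl ⟨_, Or.inl ⟨_, hq, rfl⟩, projPoint_of_ne hq⟩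

theorem exists_eq_mul_of_cross_mul_eq {X Y : ℂ} {x y : ℝ} (hxy : x ≠ 0 ∨ y ≠ 0)
    (h : X * y = Y * x) : ∃ l : ℂ, X = l * x ∧ Y = l * y := by
  rcases hxy with hx | hy
  · have hx' : (x : ℂ) ≠ 0 := by exact_mod_cast hx
    refine ⟨X / x, by field_simp, ?_⟩
    field_simp
    linear_combination -h
  · have hy' : (y : ℂ) ≠ 0 := by exact_mod_cast hy
    refine ⟨Y / y, ?_, by field_simp⟩
    field_simp
    linear_combination h

/-- An invertible complex matrix mapping `ℝ̂` into `ℝ̂` is a scalar multiple of a real matrix. -/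
theorem exists_real_matrix_of_maps_real {a b c d : ℂ} (hdet : a * d - b * c ≠ 0)
    (h : ∀ x y : ℝ, (x ≠ 0 ∨ y ≠ 0) → ∃ x' y' : ℝ, (x' ≠ 0 ∨ y' ≠ 0) ∧
      (a * x + b * y) * y' = (c * x + d * y) * x') :
    ∃ (μ : ℂ) (p q r s : ℝ), a = μ * p ∧ b = μ * q ∧ c = μ * r ∧ d = μ * s := by
  obtain ⟨p₁, q₁, hpq₁, h₁⟩ := h 1 0 (by simp)
  obtain ⟨p₂, q₂, hpq₂, h₂⟩ := h 0 1 (by simp)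
  obtain ⟨p₃, q₃, hpq₃, h₃⟩ := h 1 1 (by simp)
  obtain ⟨l₁, ha, hc⟩ := exists_eq_mul_of_cross_mul_eq hpq₁ h₁
  obtain ⟨l₂, hb, hd⟩ := exists_eq_mul_of_cross_mul_eq hpq₂ h₂
  obtain ⟨l₃, hab, hcd⟩ := exists_eq_mul_of_cross_mul_eq hpq₃ h₃
  simp only [ofReal_one, ofReal_zero, mul_one, mul_zero, add_zero, zero_add]
    at ha hb hc hd hab hcd
  have hD : ((p₁ * q₂ - p₂ * q₁ : ℝ) : ℂ) ≠ 0 := by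
    intro h0
    apply hdet
    push_cast at h0
    rw [ha, hb, hc, hd]
    linear_combination l₁ * l₂ * h0
  obtain ⟨k₁, e₁⟩ : ∃ k₁ : ℝ, l₁ = l₃ * k₁ := by
    refine ⟨(p₃ * q₂ - q₃ * p₂) / (p₁ * q₂ - p₂ * q₁), ?_⟩
    rw [ofReal_div, mul_div_assoc', eq_div_iff hD]
    push_cast
    linear_combination (q₂ : ℂ) * (hab - ha - hb) - (p₂ : ℂ) * (hcd - hc - hd)
  obtain ⟨k₂, e₂⟩ : ∃ k₂ : ℝ, l₂ = l₃ * k₂ := by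
    refine ⟨(p₁ * q₃ - q₁ * p₃) / (p₁ * q₂ - p₂ * q₁), ?_⟩
    rw [ofReal_div, mul_div_assoc', eq_div_iff hD]
    push_cast
    linear_combination (p₁ : ℂ) * (hcd - hc - hd) - (q₁ : ℂ) * (hab - ha - hb)
  refine ⟨l₃, k₁ * p₁, k₂ * p₂, k₁ * q₁, k₂ * q₂, ?_, ?_, ?_, ?_⟩
  · rw [ha, e₁, ofReal_mul, mul_assoc]
  · rw [hb, e₂, ofReal_mul, mul_assoc]
  · rw [hc, e₁, ofReal_mul, mul_assoc]
  · rw [hd, e₂, ofReal_mul, mul_assoc]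

/-- Changing `M` to a multiple of `A M R` with `A` affine and `R ∈ GL₂(ℤ)` transforms the circle
by `A`. -/
theorem affExt_image_mobius {α β γ δ α' β' γ' δ' ε η u : ℂ} {p q r s : ℤ} (hu : u ≠ 0)
    (hdet : (p * s - q * r) * (p * s - q * r) = 1)
    (hα : α' = u * (ε * (p * α + r * γ) + η * (p * β + r * δ))) (hβ : β' = u * (p * β + r * δ))
    (hγ : γ' = u * (ε * (q * α + s * γ) + η * (q * β + s * δ))) (hδ : δ' = u * (q * β + s * δ)) :
    affExt ε η '' mobius α β γ δ = mobius α' β' γ' δ' := by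
  have hdetR : ((p : ℝ) * s - q * r) * (p * s - q * r) = 1 := by exact_mod_cast hdet
  have key : ∀ x y X Y : ℝ, X = p * x + q * y → Y = r * x + s * y →
      affExt ε η (projPoint (α * X + γ * Y) (β * X + δ * Y))
        = projPoint (α' * x + γ' * y) (β' * x + δ' * y) := by
    rintro x y X Y rfl rfl
    rw [affExt_projPoint, ← projPoint_smul hu, hα, hβ, hγ, hδ]
    congr 1 <;> (push_cast; ring)
  ext w
  simp only [Set.mem_image, mem_mobius_iff]
  constructor
  · rintro ⟨_, ⟨X, Y, hXY, rfl⟩, rfl⟩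
    have hX : X = p * ((p * s - q * r) * (s * X - q * Y))
        + q * ((p * s - q * r) * (p * Y - r * X)) := by
      linear_combination (-X) * hdetR
    have hY : Y = r * ((p * s - q * r) * (s * X - q * Y))
        + s * ((p * s - q * r) * (p * Y - r * X)) := by
      linear_combination (-Y) * hdetR
    refine ⟨_, _, ?_, key _ _ X Y hX hY⟩
    by_contra! h0
    rw [h0.1, h0.2] at hX hY
    simp [hX, hY] at hXY
  · rintro ⟨x, y, hxy, rfl⟩
    refine ⟨_, ⟨_, _, ?_, rfl⟩, key x y _ _ rfl rfl⟩
    by_contra! h0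
    have hx : x = 0 := by
      linear_combination (-x) * hdetR + (p * s - q * r) * (s * h0.1 - q * h0.2)
    have hy : y = 0 := by
      linear_combination (-y) * hdetR + (p * s - q * r) * (p * h0.2 - r * h0.1)
    simp [hx, hy] at hxy

/-- Two `ℤ`-linearly dependent elements span a cyclic group. -/
theorem exists_common_generator {R : Type*} [CommRing R] [IsDomain R] [CharZero R]
    {x y : R} {m n : ℤ} (hmn : m ≠ 0 ∨ n ≠ 0)
    (h : (m : R) * x = n * y) :
    ∃ p q s t : ℤ, s * p + t * q = 1 ∧ x = p * (s * x + t * y) ∧ y = q * (s * x + t * y) := by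
  have hg : 0 < Int.gcd m n := Int.gcd_pos_iff.mpr hmn
  obtain ⟨m', n', hcop, hm, hn⟩ := Int.exists_gcd_one hg
  obtain ⟨a, b, hab⟩ := Int.isCoprime_iff_gcd_eq_one.mpr hcop
  have hg' : ((Int.gcd m n : ℤ) : R) ≠ 0 := by exact_mod_cast hg.ne'
  have h' : (m' : R) * x = n' * y := by
    apply mul_left_cancel₀ hg'
    have hm' : (m : R) = m' * (Int.gcd m n : ℤ) := by
      exact_mod_cast congrArg (Int.cast (R := R)) hm
    have hn' : (n : R) = n' * (Int.gcd m n : ℤ) := by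
      exact_mod_cast congrArg (Int.cast (R := R)) hn
    linear_combination h - x * hm' + y * hn'
  have hab' : (a : R) * m' + b * n' = 1 := by exact_mod_cast congrArg (Int.cast (R := R)) hab
  refine ⟨n', m', b, a, by linarith, ?_, ?_⟩
  · linear_combination (-x) * hab' + a * h'
  · linear_combination (-y) * hab' - b * h'

/-- Bases of homothetic lattices, possibly degenerate, differ by an element of `GL₂(ℤ)`. -/
theorem exists_unimodular_of_lattice_eq {R : Type*} [CommRing R] [IsDomain R] [CharZero R]
    {u b d b' d' : R} (hu : u ≠ 0) (hbd : b ≠ 0 ∨ d ≠ 0)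
    (h : ∀ x : R, (∃ m n : ℤ, x = m * b' + n * d') ↔ ∃ m n : ℤ, x = u * (m * b + n * d)) :
    ∃ p q r s : ℤ, (p * s - q * r) * (p * s - q * r) = 1 ∧
      b' = u * (p * b + r * d) ∧ d' = u * (q * b + s * d) := by
  by_cases hdep : ∃ m n : ℤ, (m ≠ 0 ∨ n ≠ 0) ∧ (m : R) * b = n * d
  · obtain ⟨m₀, n₀, hmn, h₀⟩ := hdep
    obtain ⟨m, n, s, t, hst, hb, hd⟩ := exists_common_generator hmn h₀
    set g := (s : R) * b + t * d with hg
    have hg0 : g ≠ 0 := by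
      intro h0
      rw [h0, mul_zero] at hb hd
      exact hbd.elim (· hb) (· hd)
    obtain ⟨m₁, n₁, h₁⟩ := (h b').1 ⟨1, 0, by simp⟩
    obtain ⟨m₂, n₂, h₂⟩ := (h d').1 ⟨0, 1, by simp⟩
    obtain ⟨a, e, h₃⟩ := (h (u * g)).2 ⟨s, t, rfl⟩
    have hb' : b' = u * ((m₁ * m + n₁ * n : ℤ) * g) := by
      push_cast
      linear_combination h₁ + u * m₁ * hb + u * n₁ * hd
    have hd' : d' = u * ((m₂ * m + n₂ * n : ℤ) * g) := by
      push_cast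
      linear_combination h₂ + u * m₂ * hb + u * n₂ * hd
    generalize m₁ * m + n₁ * n = m' at hb'
    generalize m₂ * m + n₂ * n = n' at hd'
    have hae : a * m' + e * n' = 1 := by
      have : ((a * m' + e * n' : ℤ) : R) = (1 : ℤ) := by
        apply mul_left_cancel₀ (mul_ne_zero hu hg0)
        push_cast
        linear_combination -h₃ - a * hb' - e * hd'
      exact_mod_cast this
    have hst' : (s : R) * m + t * n = 1 := by exact_mod_cast congrArg (Int.cast (R := R)) hst
    refine ⟨s * m' + n * e, s * n' - n * a, t * m' - m * e, t * n' + m * a, ?_, ?_, ?_⟩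
    · have : (s * m' + n * e) * (t * n' + m * a) - (s * n' - n * a) * (t * m' - m * e) = 1 := by
        linear_combination (a * m' + e * n') * hst + hae
      rw [this, one_mul]
    · push_cast
      linear_combination hb' - u * m' * hg - u * e * (n * hb - m * hd)
    · push_cast
      linear_combination hd' - u * n' * hg + u * a * (n * hb - m * hd)
  · have indep : ∀ k l k' l' : ℤ, (k : R) * b + l * d = k' * b + l' * d → k = k' ∧ l = l' := by
      intro k l k' l' e
      by_contra hne
      refine hdep ⟨k - k', l' - l, by omega, ?_⟩
      push_cast
      linear_combination e
    obtain ⟨p, r, h₁⟩ := (h b').1 ⟨1, 0, by simp⟩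
    obtain ⟨q, s, h₂⟩ := (h d').1 ⟨0, 1, by simp⟩
    obtain ⟨p', r', h₃⟩ := (h (u * b)).2 ⟨1, 0, by simp⟩
    obtain ⟨q', s', h₄⟩ := (h (u * d)).2 ⟨0, 1, by simp⟩
    obtain ⟨i₁, i₂⟩ := indep (p' * p + r' * q) (p' * r + r' * s) 1 0 (by
      apply mul_left_cancel₀ hu
      push_cast
      linear_combination -h₃ - p' * h₁ - r' * h₂)
    obtain ⟨i₃, i₄⟩ := indep (q' * p + s' * q) (q' * r + s' * s) 0 1 (by
      apply mul_left_cancel₀ hu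
      push_cast
      linear_combination -h₄ - q' * h₁ - s' * h₂)
    refine ⟨p, q, r, s, ?_, h₁, h₂⟩
    have hdet : (p' * s' - q' * r') * (p * s - q * r) = 1 := by
      linear_combination (q' * r + s' * s) * i₁ + i₄ - (q' * p + s' * q) * i₂
    have := Int.isUnit_iff.1 (IsUnit.of_mul_eq_one_right _ hdet)
    rcases this with h | h <;> rw [h] <;> rfl

theorem lattice_eq_of_unimodular {R : Type*} [CommRing R]
    {u l b d b' d' : R} {p q r s : ℤ} (hul : u * l = 1)
    (hdet : (p * s - q * r) * (p * s - q * r) = 1)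
    (hb : b = l * (p * b' + r * d')) (hd : d = l * (q * b' + s * d')) (x : R) :
    (∃ m n : ℤ, x = m * b' + n * d') ↔ ∃ m n : ℤ, x = u * (m * b + n * d) := by
  have hdet' : ((p : R) * s - q * r) * (p * s - q * r) = 1 := by
    simpa using congrArg (Int.cast (R := R)) hdet
  constructor
  · rintro ⟨m, n, rfl⟩
    refine ⟨(p * s - q * r) * (m * s - n * q), (p * s - q * r) * (n * p - m * r), ?_⟩
    rw [hb, hd]
    push_cast
    linear_combination (-(m * b' + n * d')) * (hdet' + hul * ((p : R) * s - q * r) ^ 2)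
  · rintro ⟨m, n, rfl⟩
    refine ⟨m * p + n * q, m * r + n * s, ?_⟩
    rw [hb, hd]
    push_cast
    linear_combination ((m * p + n * q) * b' + (m * r + n * s) * d') * hul

/-- In an imaginary quadratic field only the rational numbers are real. -/
theorem exists_rat_of_conj_eq {K : Type*} [Field K] [NumberField K]
    (hdeg : Module.finrank ℚ K = 2) (hdisc : NumberField.discr K < 0) (ι : K →+* ℂ) {x : K}
    (hx : conj (ι x) = ι x) : ∃ q : ℚ, x = q := by
  have := Subalgebra.isSimpleOrder_of_finrank_prime ℚ K (hdeg ▸ Nat.prime_two)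
  let E := AlgHom.equalizer ((starRingEnd ℂ).comp ι).toRatAlgHom ι.toRatAlgHom
  have hxE : x ∈ E := hx
  rcases eq_bot_or_eq_top E with hE | hE
  · rw [hE] at hxE
    obtain ⟨q, hq⟩ := Algebra.mem_bot.1 hxE
    exact ⟨q, by rw [← hq, eq_ratCast]⟩
  · exfalso
    classical
    have hreal : ComplexEmbedding.IsReal ι := by
      ext z
      exact (hE ▸ Algebra.mem_top : z ∈ E)
    have hpos : 0 < InfinitePlace.nrRealPlaces K := by
      rw [← InfinitePlace.card_real_embeddings]
      exact Fintype.card_pos_iff.2 ⟨⟨ι, hreal⟩⟩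
    have hrank := InfinitePlace.card_add_two_mul_card_eq_rank K
    have hsign := NumberField.sign_discr K
    rw [show InfinitePlace.nrComplexPlaces K = 0 by omega,
      Int.sign_eq_neg_one_of_neg hdisc] at hsign
    norm_num at hsign

/-- Elements of `O_K` with a real ratio are `ℤ`-linearly dependent. -/
theorem exists_int_dependence {K : Type} [Field K] [NumberField K]
    (hdeg : Module.finrank ℚ K = 2) (hdisc : NumberField.discr K < 0) (ι : K →+* ℂ)
    {x y : 𝓞 K} {μ : ℂ} {r s : ℝ} (hx : emb K ι x = μ * r) (hy : emb K ι y = μ * s) :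
    ∃ m n : ℤ, (m ≠ 0 ∨ n ≠ 0) ∧ (m : 𝓞 K) * x = n * y := by
  by_cases hy0 : y = 0
  · exact ⟨0, 1, by simp, by simp [hy0]⟩
  have hyK : (y : K) ≠ 0 := by simpa using hy0
  have hμs : μ * s ≠ 0 := by
    rw [← hy]
    exact (map_ne_zero ι).2 hyK
  obtain ⟨hμ, hs⟩ := mul_ne_zero_iff.1 hμs
  have hι : ι (x / y : K) = ((r / s : ℝ) : ℂ) := by
    rw [map_div₀]
    change emb K ι x / emb K ι y = _
    rw [hx, hy, mul_div_mul_left _ _ hμ, ofReal_div]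
  obtain ⟨q, hq⟩ := exists_rat_of_conj_eq hdeg hdisc ι (x := (x / y : K)) (by
    rw [hι, conj_ofReal])
  refine ⟨q.den, q.num, Or.inl (by exact_mod_cast q.den_ne_zero), ?_⟩
  apply RingOfIntegers.coe_injective
  rw [div_eq_iff hyK] at hq
  have hq' : (q : K) * q.den = q.num := by exact_mod_cast Rat.mul_den_eq_num q
  simp only [map_mul, map_intCast, Int.cast_natCast, map_natCast]
  linear_combination (q.den : K) * hq + (y : K) * hq'

/-- An integral matrix of unit determinant which is a multiple of a real matrix is a unit
multiple of an element of `GL₂(ℤ)`. -/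
theorem exists_unit_mul_unimodular {K : Type} [Field K] [NumberField K]
    (hdeg : Module.finrank ℚ K = 2) (hdisc : NumberField.discr K < 0) (ι : K →+* ℂ)
    {a b c d : 𝓞 K} (hdet : IsUnit (a * d - b * c)) {μ : ℂ} {a₁ b₁ c₁ d₁ : ℝ}
    (ha : emb K ι a = μ * a₁) (hb : emb K ι b = μ * b₁)
    (hc : emb K ι c = μ * c₁) (hd : emb K ι d = μ * d₁) :
    ∃ (l : (𝓞 K)ˣ) (p q r s : ℤ), (p * s - q * r) * (p * s - q * r) = 1 ∧
      a = l * p ∧ b = l * q ∧ c = l * r ∧ d = l * s := by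
  obtain ⟨m, n, hmn, h⟩ := exists_int_dependence hdeg hdisc ι ha hb
  obtain ⟨p, q, s, t, -, ha', hb'⟩ := exists_common_generator hmn h
  obtain ⟨m', n', hmn', h'⟩ := exists_int_dependence hdeg hdisc ι hc hd
  obtain ⟨p', q', s', t', -, hc', hd'⟩ := exists_common_generator hmn' h'
  have hg : emb K ι (s * a + t * b) = μ * (s * a₁ + t * b₁ : ℝ) := by
    have : emb K ι (s * a + t * b) = s * emb K ι a + t * emb K ι b := by simp [emb]
    rw [this, ha, hb]
    push_cast
    ring
  have hg' : emb K ι (s' * c + t' * d) = μ * (s' * c₁ + t' * d₁ : ℝ) := by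
    have : emb K ι (s' * c + t' * d) = s' * emb K ι c + t' * emb K ι d := by simp [emb]
    rw [this, hc, hd]
    push_cast
    ring
  generalize (s : 𝓞 K) * a + t * b = g at *
  generalize (s' : 𝓞 K) * c + t' * d = g' at *
  obtain ⟨k, l, hkl, e⟩ := exists_int_dependence hdeg hdisc ι hg hg'
  obtain ⟨i, j, v, w, -, hi, hj⟩ := exists_common_generator hkl e
  generalize (v : 𝓞 K) * g + w * g' = z at *
  have hfac : a * d - b * c
      = z * (z * ((p * i * (q' * j) - q * i * (p' * j) : ℤ) : 𝓞 K)) := by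
    rw [ha', hb', hc', hd', hi, hj]
    push_cast
    ring
  rw [hfac] at hdet
  have hz : IsUnit z := isUnit_of_mul_isUnit_left hdet
  have hD := isUnit_of_mul_isUnit_right (isUnit_of_mul_isUnit_right hdet)
  have hD' : IsUnit (p * i * (q' * j) - q * i * (p' * j)) := by
    have := hD.map (Algebra.norm ℤ)
    rw [← eq_intCast (algebraMap ℤ (𝓞 K)), Algebra.norm_algebraMap, RingOfIntegers.rank, hdeg,
      isUnit_pow_iff two_ne_zero] at this
    exact this
  refine ⟨hz.unit, p * i, q * i, p' * j, q' * j, Int.isUnit_mul_self hD', ?_, ?_, ?_, ?_⟩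
  all_goals
    rw [IsUnit.unit_spec]
    push_cast
  · rw [ha', hi]; ring
  · rw [hb', hi]; ring
  · rw [hc', hj]; ring
  · rw [hd', hj]; ring

/-- For `M, M′ ∈ SL₂(O_K)` the following are equivalent:
(i) some map `z ↦ εz + η` with `ε ∈ O_K^×`, `η ∈ O_K` (fixing `∞`) carries `M(ℝ̂)` onto
`M′(ℝ̂)`; (ii) the lattices spanned by the bottom rows agree up to a unit:
`ℤβ′ + ℤδ′ = u·(ℤβ + ℤδ)` for some `u ∈ O_K^×`. -/
theorem stmt12 (K : Type) [Field K] [NumberField K]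
    (hdeg : Module.finrank ℚ K = 2) (hdisc : NumberField.discr K < 0)
    (ι : K →+* ℂ)
    (M M' : Matrix.SpecialLinearGroup (Fin 2) (RingOfIntegers K)) :
    (∃ ε : (RingOfIntegers K)ˣ, ∃ η : RingOfIntegers K,
        affExt (emb K ι (ε : RingOfIntegers K)) (emb K ι η) '' bianchiCircle K ι M
          = bianchiCircle K ι M')
      ↔ (∃ u : (RingOfIntegers K)ˣ, ∀ x : RingOfIntegers K,
          (∃ m n : ℤ, x = m • M'.1 1 0 + n • M'.1 1 1)
            ↔ (∃ m n : ℤ, x = (u : RingOfIntegers K) * (m • M.1 1 0 + n • M.1 1 1))) := by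
  have hM : M.1 0 0 * M.1 1 1 - M.1 0 1 * M.1 1 0 = 1 := by
    rw [← Matrix.det_fin_two, M.2]
  have hM' : M'.1 0 0 * M'.1 1 1 - M'.1 0 1 * M'.1 1 0 = 1 := by
    rw [← Matrix.det_fin_two, M'.2]
  simp only [bianchiCircle, zsmul_eq_mul]
  generalize M.1 0 0 = α, M.1 0 1 = γ, M.1 1 0 = β, M.1 1 1 = δ at *
  generalize M'.1 0 0 = α', M'.1 0 1 = γ', M'.1 1 0 = β', M'.1 1 1 = δ' at *
  constructor
  · rintro ⟨ε, η, h⟩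
    obtain ⟨a, ha⟩ : ∃ a, a = δ' * (ε * α + η * β) - γ' * β := ⟨_, rfl⟩
    obtain ⟨b, hb⟩ : ∃ b, b = δ' * (ε * γ + η * δ) - γ' * δ := ⟨_, rfl⟩
    obtain ⟨c, hc⟩ : ∃ c, c = α' * β - β' * (ε * α + η * β) := ⟨_, rfl⟩
    obtain ⟨d, hd⟩ : ∃ d, d = α' * δ - β' * (ε * γ + η * δ) := ⟨_, rfl⟩
    have hdet : a * d - b * c = ε := by
      rw [ha, hb, hc, hd]
      linear_combination ε * (α * δ - γ * β) * hM' + ε * hM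
    have hdetC : emb K ι a * emb K ι d - emb K ι b * emb K ι c ≠ 0 := by
      have e : emb K ι a * emb K ι d - emb K ι b * emb K ι c = emb K ι ε := by
        rw [← hdet]
        simp [emb]
      rw [e]
      simp [emb]
    have hreal : ∀ x y : ℝ, (x ≠ 0 ∨ y ≠ 0) → ∃ x' y' : ℝ, (x' ≠ 0 ∨ y' ≠ 0) ∧
        (emb K ι a * x + emb K ι b * y) * y' = (emb K ι c * x + emb K ι d * y) * x' := by
      intro x y hxy
      have hmem := h ▸ Set.mem_image_of_mem (affExt (emb K ι ε) (emb K ι η))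
        (mem_mobius_iff.2 ⟨x, y, hxy, rfl⟩)
      obtain ⟨x', y', hxy', e⟩ := mem_mobius_iff.1 hmem
      rw [affExt_projPoint] at e
      have := cross_mul_eq_of_projPoint_eq e
      refine ⟨x', y', hxy', ?_⟩
      rw [ha, hb, hc, hd]
      simp only [emb, map_sub, map_add, map_mul] at this ⊢
      linear_combination this
    obtain ⟨μ, a₁, b₁, c₁, d₁, ha₁, hb₁, hc₁, hd₁⟩ := exists_real_matrix_of_maps_real hdetC hreal
    obtain ⟨l, p, q, r, s, hD, hp, hq, hr, hs⟩ := exists_unit_mul_unimodular hdeg hdisc ι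
      (hdet ▸ ε.isUnit) ha₁ hb₁ hc₁ hd₁
    refine ⟨l⁻¹, lattice_eq_of_unimodular (l := (l : 𝓞 K)) l.inv_mul hD ?_ ?_⟩
    · linear_combination (-β) * hM' - β' * ha - δ' * hc + β' * hp + δ' * hr
    · linear_combination (-δ) * hM' - β' * hb - δ' * hd + β' * hq + δ' * hs
  · rintro ⟨u, h⟩
    have hβδ : β ≠ 0 ∨ δ ≠ 0 := by
      by_contra! h0
      simp [h0.1, h0.2] at hM
    obtain ⟨p, q, r, s, hD, hβ, hδ⟩ := exists_unimodular_of_lattice_eq u.ne_zero hβδ h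
    have hD' : ((p : 𝓞 K) * s - q * r) * (p * s - q * r) = 1 := by
      exact_mod_cast congrArg (Int.cast (R := 𝓞 K)) hD
    have huv : (u : 𝓞 K) * (u⁻¹ : (𝓞 K)ˣ) = 1 := u.mul_inv
    obtain ⟨D, hDD⟩ : ∃ D : (𝓞 K)ˣ, (D : 𝓞 K) = p * s - q * r := ⟨⟨_, _, hD', hD'⟩, rfl⟩
    generalize u⁻¹ = v at huv
    have hDsq : (D : 𝓞 K) * D = 1 := by rw [hDD, hD']
    have hN : (p * α + r * γ) * (q * β + s * δ) - (p * β + r * δ) * (q * α + s * γ) = D := by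
      rw [hDD]
      linear_combination ((p : 𝓞 K) * s - q * r) * hM
    have hv : (v : 𝓞 K) = α' * (q * β + s * δ) - γ' * (p * β + r * δ) := by
      rw [hβ, hδ] at hM'
      linear_combination (-v) * hM' + (α' * (q * β + s * δ) - γ' * (p * β + r * δ)) * huv
    have hη : ∃ η : 𝓞 K,
        α' = u * ((D * v * v : (𝓞 K)ˣ) * (p * α + r * γ) + η * (p * β + r * δ)) ∧
        γ' = u * ((D * v * v : (𝓞 K)ˣ) * (q * α + s * γ) + η * (q * β + s * δ)) := by
      clear hβ hδ hDD
      generalize (p : 𝓞 K) * α + r * γ = A, (q : 𝓞 K) * α + s * γ = C,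
        (p : 𝓞 K) * β + r * δ = B, (q : 𝓞 K) * β + s * δ = E at *
      refine ⟨v * D * (γ' * A - α' * C), ?_, ?_⟩
      · push_cast
        linear_combination (-D * (v * A + (γ' * A - α' * C) * B)) * huv - D * A * hv
          - D * α' * hN - α' * hDsq
      · push_cast
        linear_combination (-D * (v * C + (γ' * A - α' * C) * E)) * huv - D * C * hv
          - D * γ' * hN - γ' * hDsq
    obtain ⟨η, hα, hγ⟩ := hη
    have hu : emb K ι u ≠ 0 := by simp [emb]
    refine ⟨D * v * v, η, affExt_image_mobius hu hD ?_ ?_ ?_ ?_⟩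
    · simpa [emb] using congrArg (emb K ι) hα
    · simpa [emb] using congrArg (emb K ι) hβ
    · simpa [emb] using congrArg (emb K ι) hγ
    · simpa [emb] using congrArg (emb K ι) hδ
end

section
/- Fix an integer f ≥ 1. (a) For every β ∈ O_K whose image in O_K/fO_K is a unit, the lattice Λ_β := fO_K + ℤβ is an additive subgroup of O_K of index f admitting a ℤ-basis of coprime elements (i.e. Λ_β is primeval of conductor f); (b) conversely, every additive subgroup Λ ⊆ O_K of index f admitting a ℤ-basis of coprime elements equals Λ_β for some such β; and (c) for β, β′ with images units in O_K/fO_K, one has Λ_β = Λ_{β′} if and only if β′ ≡ nβ (mod fO_K) for some integer n coprime to f. Consequently β ↦ Λ_β induces a bijection from (O_K/fO_K)^× modulo the image of (ℤ/fℤ)^× onto the set of primeval lattices of conductor f. -/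
open Complex ComplexConjugate NumberField

/-- The lattice `Λ_β := fO_K + ℤβ` inside the ring of integers of `K`. -/
def latOf (K : Type) [Field K] [NumberField K] (f : ℕ) (β : RingOfIntegers K) :
    AddSubgroup (RingOfIntegers K) :=
  (Ideal.span {(f : RingOfIntegers K)}).toAddSubgroup ⊔ AddSubgroup.zmultiples β

/-- `Λ` is primeval of conductor `f`: it has index `f` in `O_K` and admits a `ℤ`-basis of
coprime elements. -/
def IsPrimevalOf (K : Type) [Field K] [NumberField K] (f : ℕ)
    (Λ : AddSubgroup (RingOfIntegers K)) : Prop :=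
  Λ.index = f ∧ ∃ β δ : RingOfIntegers K, IsCoprime β δ ∧
    ∀ x : RingOfIntegers K, x ∈ Λ ↔ ∃ m n : ℤ, x = m • β + n • δ

/-- The image of `(ℤ/fℤ)^×` in `(O_K/fO_K)^×`: the subgroup generated by the classes of
rational integers coprime to `f`. -/
def intSubgrp (K : Type) [Field K] [NumberField K] (f : ℕ) :
    Subgroup (RingOfIntegers K ⧸ Ideal.span {(f : RingOfIntegers K)})ˣ :=
  Subgroup.closure
    {x | ∃ n : ℤ, Int.gcd n f = 1 ∧
        (x : RingOfIntegers K ⧸ Ideal.span {(f : RingOfIntegers K)})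
          = Ideal.Quotient.mk (Ideal.span {(f : RingOfIntegers K)})
              ((n : RingOfIntegers K))}

section FreeModule

variable {M : Type*} [AddCommGroup M]

/-- Stacked bases for a finite-index subgroup of a free abelian group of rank two. -/
theorem AddSubgroup.exists_smith_basis_fin_two (b : Module.Basis (Fin 2) ℤ M)
    (Λ : AddSubgroup M) (hΛ : Λ.index ≠ 0) :
    ∃ (e : Module.Basis (Fin 2) ℤ M) (a c : ℤ), Λ.index = (a * c).natAbs ∧
      ∀ x, x ∈ Λ ↔ ∃ m n : ℤ, x = m • a • e 0 + n • c • e 1 := by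
  have : Module.Free ℤ M := .of_basis b
  have : Module.Finite ℤ M := .of_basis b
  let N : Submodule ℤ M := Λ.toIntSubmodule
  have hfin : Finite (M ⧸ N) := Nat.finite_of_card_ne_zero hΛ
  have h := N.finiteQuotient_iff.mp hfin
  refine ⟨N.smithNormalFormTopBasis b h, N.smithNormalFormCoeffs b h 0,
    N.smithNormalFormCoeffs b h 1, ?_, fun x ↦ ?_⟩
  · have := Nat.card_congr (N.quotientEquivPiZMod b h).toEquiv
    rw [Nat.card_pi, Fin.prod_univ_two, Nat.card_zmod, Nat.card_zmod, ← Int.natAbs_mul] at this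
    exact this
  · change x ∈ N ↔ _
    rw [(N.smithNormalFormBotBasis b h).mem_submodule_iff']
    simp only [Fin.sum_univ_two, Submodule.smithNormalFormBotBasis_def]
    exact ⟨fun ⟨c, hc⟩ ↦ ⟨c 0, c 1, hc⟩, fun ⟨m, n, hx⟩ ↦ ⟨![m, n], by simpa using hx⟩⟩

/-- Divisibility of rational integers is reflected by a ring that is free over `ℤ`. -/
theorem Module.Basis.intCast_dvd_intCast {ι R : Type*} [Nonempty ι] [CommRing R]
    (b : Module.Basis ι ℤ R) {m n : ℤ} : (m : R) ∣ (n : R) ↔ m ∣ n := by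
  refine ⟨fun ⟨y, hy⟩ ↦ ?_, fun h ↦ by simpa using map_dvd (Int.castRingHom R) h⟩
  let i : ι := Classical.arbitrary ι
  have h : n • b i = m • (y * b i) := by
    rw [zsmul_eq_mul, zsmul_eq_mul, hy, mul_assoc]
  have := congrArg (fun z ↦ b.repr z i) h
  exact ⟨b.repr (y * b i) i, by simpa [-zsmul_eq_mul] using this⟩

end FreeModule

section PrimevalLattice

variable {K : Type} [Field K] [NumberField K] {f : ℕ}

theorem mem_latOf_iff {β x : 𝓞 K} :
    x ∈ latOf K f β ↔ ∃ (y : 𝓞 K) (n : ℤ), x = f * y + n * β := by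
  simp only [latOf, AddSubgroup.mem_sup, AddSubgroup.mem_zmultiples_iff,
    Submodule.mem_toAddSubgroup, Ideal.mem_span_singleton', zsmul_eq_mul]
  constructor
  · rintro ⟨_, ⟨y, rfl⟩, _, ⟨n, rfl⟩, rfl⟩
    exact ⟨y, n, by rw [mul_comm y]⟩
  · rintro ⟨y, n, rfl⟩
    exact ⟨_, ⟨y, rfl⟩, _, ⟨n, rfl⟩, by rw [mul_comm y]⟩

theorem latOf_eq_comap (β : 𝓞 K) :
    latOf K f β =
      (AddSubgroup.zmultiples (Ideal.Quotient.mk (Ideal.span {(f : 𝓞 K)}) β)).comap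
        (Ideal.Quotient.mk (Ideal.span {(f : 𝓞 K)})).toAddMonoidHom := by
  ext x
  simp only [mem_latOf_iff, AddSubgroup.mem_comap, AddSubgroup.mem_zmultiples_iff,
    RingHom.toAddMonoidHom_eq_coe, AddMonoidHom.coe_coe, zsmul_eq_mul]
  constructor
  · rintro ⟨y, n, rfl⟩
    exact ⟨n, by
      simp [Ideal.Quotient.eq_zero_iff_mem.mpr (Ideal.mem_span_singleton_self (f : 𝓞 K))]⟩
  · rintro ⟨n, hn⟩
    obtain ⟨y, hy⟩ := Ideal.mem_span_singleton'.mp (Ideal.Quotient.eq.mp hn.symm)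
    exact ⟨y, n, by linear_combination -hy⟩

theorem Ideal.Quotient.intCast_eq_zero_iff_natCast_dvd (n : ℤ) :
    ((n : ℤ) : 𝓞 K ⧸ Ideal.span {(f : 𝓞 K)}) = 0 ↔ (f : ℤ) ∣ n := by
  have : Nonempty (Module.Free.ChooseBasisIndex ℤ (𝓞 K)) :=
    (RingOfIntegers.basis K).index_nonempty
  rw [← map_intCast (Ideal.Quotient.mk (Ideal.span {(f : 𝓞 K)})), Ideal.Quotient.eq_zero_iff_mem,
    Ideal.mem_span_singleton, ← (RingOfIntegers.basis K).intCast_dvd_intCast, Int.cast_natCast]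

theorem exists_intCast_mul_eq_one {n : ℤ} (hn : Int.gcd n f = 1) :
    ∃ m : ℤ, Int.gcd m f = 1 ∧ ((m : ℤ) : 𝓞 K ⧸ Ideal.span {(f : 𝓞 K)}) * (n : ℤ) = 1 := by
  obtain ⟨m, k, h⟩ := Int.isCoprime_iff_gcd_eq_one.mpr hn
  refine ⟨m, Int.isCoprime_iff_gcd_eq_one.mp ⟨n, k, by linear_combination h⟩, ?_⟩
  have := (Ideal.Quotient.intCast_eq_zero_iff_natCast_dvd (K := K) (f := f) (m * n - 1)).mpr
    ⟨-k, by linear_combination h⟩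
  push_cast at this
  linear_combination this

theorem zmultiples_unit_eq_iff (u v : (𝓞 K ⧸ Ideal.span {(f : 𝓞 K)})ˣ) :
    AddSubgroup.zmultiples (u : 𝓞 K ⧸ Ideal.span {(f : 𝓞 K)}) = AddSubgroup.zmultiples ↑v ↔
      ∃ n : ℤ, Int.gcd n f = 1 ∧ (v : 𝓞 K ⧸ Ideal.span {(f : 𝓞 K)}) = n * u := by
  constructor
  · intro h
    obtain ⟨n, hn⟩ := AddSubgroup.mem_zmultiples_iff.mp (h ▸ AddSubgroup.mem_zmultiples _ :
      (v : 𝓞 K ⧸ Ideal.span {(f : 𝓞 K)}) ∈ AddSubgroup.zmultiples ↑u)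
    obtain ⟨m, hm⟩ := AddSubgroup.mem_zmultiples_iff.mp (h ▸ AddSubgroup.mem_zmultiples _ :
      (u : 𝓞 K ⧸ Ideal.span {(f : 𝓞 K)}) ∈ AddSubgroup.zmultiples ↑v)
    rw [zsmul_eq_mul] at hn hm
    refine ⟨n, ?_, hn.symm⟩
    have hmn : ((m * n - 1 : ℤ) : 𝓞 K ⧸ Ideal.span {(f : 𝓞 K)}) = 0 := by
      refine u.isUnit.mul_left_eq_zero.mp ?_
      push_cast
      linear_combination m * hn + hm
    obtain ⟨k, hk⟩ := (Ideal.Quotient.intCast_eq_zero_iff_natCast_dvd _).mp hmn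
    exact Int.isCoprime_iff_gcd_eq_one.mp ⟨m, -k, by linear_combination hk⟩
  · rintro ⟨n, hn, hv⟩
    obtain ⟨m, -, hm⟩ := exists_intCast_mul_eq_one (K := K) hn
    refine le_antisymm (AddSubgroup.zmultiples_le_of_mem ?_) (AddSubgroup.zmultiples_le_of_mem ?_)
    · exact AddSubgroup.mem_zmultiples_iff.mpr
        ⟨m, by rw [zsmul_eq_mul]; linear_combination m * hv + u.val * hm⟩
    · exact AddSubgroup.mem_zmultiples_iff.mpr ⟨n, by rw [zsmul_eq_mul, hv]⟩

theorem mem_intSubgrp_iff {x : (𝓞 K ⧸ Ideal.span {(f : 𝓞 K)})ˣ} :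
    x ∈ intSubgrp K f ↔
      ∃ n : ℤ, Int.gcd n f = 1 ∧ (x : 𝓞 K ⧸ Ideal.span {(f : 𝓞 K)}) = n := by
  constructor
  · intro h
    induction h using Subgroup.closure_induction with
    | mem x hx => simpa using hx
    | one => exact ⟨1, by simp, by simp⟩
    | mul x y _ _ hx hy =>
      obtain ⟨m, hm, hx⟩ := hx
      obtain ⟨n, hn, hy⟩ := hy
      refine ⟨m * n, ?_, by simp [hx, hy]⟩
      rw [← Int.isCoprime_iff_gcd_eq_one] at *
      exact hm.mul_left hn
    | inv x _ hx =>
      obtain ⟨n, hn, hx⟩ := hx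
      obtain ⟨m, hm, hmn⟩ := exists_intCast_mul_eq_one (K := K) hn
      exact ⟨m, hm, Units.inv_eq_of_mul_eq_one_left (by rw [hx, hmn])⟩
  · rintro ⟨n, hn, hx⟩
    exact Subgroup.subset_closure ⟨n, hn, by simpa using hx⟩

theorem latOf_eq_latOf_iff {β β' : 𝓞 K}
    (hβ : IsUnit (Ideal.Quotient.mk (Ideal.span {(f : 𝓞 K)}) β))
    (hβ' : IsUnit (Ideal.Quotient.mk (Ideal.span {(f : 𝓞 K)}) β')) :
    latOf K f β = latOf K f β' ↔ ∃ n : ℤ, Int.gcd n f = 1 ∧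
      Ideal.Quotient.mk (Ideal.span {(f : 𝓞 K)}) β' =
        Ideal.Quotient.mk (Ideal.span {(f : 𝓞 K)}) ((n : 𝓞 K) * β) := by
  rw [latOf_eq_comap, latOf_eq_comap,
    (AddSubgroup.comap_injective Ideal.Quotient.mk_surjective).eq_iff]
  simpa using zmultiples_unit_eq_iff hβ.unit hβ'.unit

theorem latOf_index (hdeg : Module.finrank ℚ K = 2) (hf : 1 ≤ f) {β : 𝓞 K}
    (hβ : IsUnit (Ideal.Quotient.mk (Ideal.span {(f : 𝓞 K)}) β)) :
    (latOf K f β).index = f := by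
  have hcard : Nat.card (𝓞 K ⧸ Ideal.span {(f : 𝓞 K)}) = f ^ 2 := by
    have h := Ideal.absNorm_span_singleton (f : 𝓞 K)
    rw [← map_natCast (algebraMap ℤ (𝓞 K)), Algebra.norm_algebraMap, RingOfIntegers.rank, hdeg,
      Int.natAbs_pow, map_natCast] at h
    exact h
  have horder : addOrderOf (Ideal.Quotient.mk (Ideal.span {(f : 𝓞 K)}) β) = f := by
    refine Nat.dvd_right_iff_eq.mp fun n ↦ ?_
    rw [addOrderOf_dvd_iff_nsmul_eq_zero, nsmul_eq_mul, hβ.mul_left_eq_zero, ← Int.cast_natCast n,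
      Ideal.Quotient.intCast_eq_zero_iff_natCast_dvd, Int.natCast_dvd_natCast]
  rw [latOf_eq_comap, AddSubgroup.index_comap_of_surjective _ Ideal.Quotient.mk_surjective]
  have h := (AddSubgroup.zmultiples
    (Ideal.Quotient.mk (Ideal.span {(f : 𝓞 K)}) β)).card_mul_index
  rw [Nat.card_zmultiples, horder, hcard, sq] at h
  exact Nat.eq_of_mul_eq_mul_left hf h

theorem nonempty_basis_fin_two (hdeg : Module.finrank ℚ K = 2) :
    Nonempty (Module.Basis (Fin 2) ℤ (𝓞 K)) :=
  ⟨Module.finBasisOfFinrankEq ℤ (𝓞 K) ((RingOfIntegers.rank K).trans hdeg)⟩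

theorem isPrimevalOf_latOf (hdeg : Module.finrank ℚ K = 2) (hf : 1 ≤ f) {β : 𝓞 K}
    (hβ : IsUnit (Ideal.Quotient.mk (Ideal.span {(f : 𝓞 K)}) β)) :
    IsPrimevalOf K f (latOf K f β) := by
  have hindex := latOf_index hdeg hf hβ
  obtain ⟨b⟩ := nonempty_basis_fin_two hdeg
  obtain ⟨e, a, c, -, he⟩ := (latOf K f β).exists_smith_basis_fin_two b (by lia)
  refine ⟨hindex, a • e 0, c • e 1, ?_, he⟩
  obtain ⟨m, n, hfmem⟩ := (he f).mp (mem_latOf_iff.mpr ⟨1, 0, by simp⟩)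
  obtain ⟨m', n', hβmem⟩ := (he β).mp (mem_latOf_iff.mpr ⟨0, 1, by simp⟩)
  obtain ⟨w, hw⟩ := hβ.exists_left_inv
  obtain ⟨z, rfl⟩ := Ideal.Quotient.mk_surjective w
  rw [← map_mul, ← map_one (Ideal.Quotient.mk _), Ideal.Quotient.eq,
    Ideal.mem_span_singleton] at hw
  obtain ⟨y, hy⟩ := hw
  simp only [zsmul_eq_mul] at hfmem hβmem ⊢
  exact ⟨z * m' - y * m, z * n' - y * n, by linear_combination hy - z * hβmem + y * hfmem⟩

theorem IsPrimevalOf.exists_eq_latOf (hdeg : Module.finrank ℚ K = 2) (hf : 1 ≤ f)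
    {Λ : AddSubgroup (𝓞 K)} (hΛ : IsPrimevalOf K f Λ) :
    ∃ β : 𝓞 K, IsUnit (Ideal.Quotient.mk (Ideal.span {(f : 𝓞 K)}) β) ∧ Λ = latOf K f β := by
  obtain ⟨hindex, γ, δ, ⟨p, q, hpq⟩, hmem⟩ := hΛ
  have hγ : γ ∈ Λ := (hmem γ).mpr ⟨1, 0, by simp⟩
  have hδ : δ ∈ Λ := (hmem δ).mpr ⟨0, 1, by simp⟩
  obtain ⟨b⟩ := nonempty_basis_fin_two hdeg
  obtain ⟨e, a, c, hac, he⟩ := Λ.exists_smith_basis_fin_two b (by lia)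
  have hcop : IsCoprime a c := by
    rw [Int.isCoprime_iff_gcd_eq_one]
    obtain ⟨a', ha'⟩ := Int.gcd_dvd_left a c
    obtain ⟨c', hc'⟩ := Int.gcd_dvd_right a c
    generalize Int.gcd a c = g at ha' hc' ⊢
    have hdvd : ∀ x ∈ Λ, ((g : ℤ) : 𝓞 K) ∣ x := by
      intro x hx
      obtain ⟨m, n, rfl⟩ := (he x).mp hx
      refine ⟨m * a' * e 0 + n * c' * e 1, ?_⟩
      simp only [zsmul_eq_mul, ha', hc']
      push_cast
      ring
    have h1 : ((g : ℤ) : 𝓞 K) ∣ ((1 : ℤ) : 𝓞 K) := by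
      rw [Int.cast_one, ← hpq]
      exact dvd_add ((hdvd γ hγ).mul_left p) ((hdvd δ hδ).mul_left q)
    exact Nat.dvd_one.mp (by exact_mod_cast e.intCast_dvd_intCast.mp h1)
  obtain ⟨s, t, hst⟩ := hcop
  obtain ⟨ε, hε⟩ : ∃ ε : ℤ, a * c = f * ε := by
    change (f : ℤ) ∣ a * c
    rw [Int.natCast_dvd, ← hindex, hac]
  have heq : Λ = latOf K f (a • e 0 + c • e 1) := by
    refine le_antisymm (fun x hx ↦ ?_) (fun x hx ↦ ?_)
    · obtain ⟨m, n, rfl⟩ := (he x).mp hx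
      refine mem_latOf_iff.mpr ⟨ε * (m - n) * (t * e 0 - s * e 1),
        m * s * a + n * t * c, ?_⟩
      have hst' := congrArg (Int.cast : ℤ → 𝓞 K) hst
      have hε' := congrArg (Int.cast : ℤ → 𝓞 K) hε
      simp only [zsmul_eq_mul]
      push_cast at hst' hε' ⊢
      linear_combination -(m * a * e 0 + n * c * e 1) * hst' + (m - n) * (t * e 0 - s * e 1) * hε'
    · obtain ⟨y, n, rfl⟩ := mem_latOf_iff.mp hx
      refine add_mem ?_ ?_
      · rw [← nsmul_eq_mul, ← hindex]
        exact Λ.nsmul_index_mem y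
      · rw [← zsmul_eq_mul]
        exact zsmul_mem ((he _).mpr ⟨1, 1, by simp⟩) n
  refine ⟨_, ?_, heq⟩
  generalize a • e 0 + c • e 1 = β at heq
  obtain ⟨y, n, hy⟩ := mem_latOf_iff.mp (heq ▸ hγ)
  obtain ⟨y', n', hy'⟩ := mem_latOf_iff.mp (heq ▸ hδ)
  refine IsUnit.of_mul_eq_one (Ideal.Quotient.mk _ (p * n + q * n')) ?_
  rw [← map_mul, ← map_one (Ideal.Quotient.mk _), Ideal.Quotient.eq, Ideal.mem_span_singleton]
  exact ⟨-(p * y + q * y'), by linear_combination hpq - p * hy - q * hy'⟩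

end PrimevalLattice

/-- Fix `f ≥ 1`. (a) For every `β ∈ O_K` whose image in `O_K/fO_K` is a
unit, `Λ_β = fO_K + ℤβ` is primeval of conductor `f`; (b) every primeval lattice of
conductor `f` equals some `Λ_β`; (c) `Λ_β = Λ_{β′}` iff `β′ ≡ nβ (mod fO_K)` for some
integer `n` coprime to `f`. Consequently `β ↦ Λ_β` induces a bijection from
`(O_K/fO_K)^×` modulo the image of `(ℤ/fℤ)^×` onto the primeval lattices of conductor `f`. -/
theorem stmt14 (K : Type) [Field K] [NumberField K]
    (hdeg : Module.finrank ℚ K = 2) (hdisc : NumberField.discr K < 0)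
    (f : ℕ) (hf : 1 ≤ f) :
    (∀ β : RingOfIntegers K,
        IsUnit (Ideal.Quotient.mk (Ideal.span {(f : RingOfIntegers K)}) β) →
        IsPrimevalOf K f (latOf K f β))
    ∧ (∀ Λ : AddSubgroup (RingOfIntegers K), IsPrimevalOf K f Λ →
        ∃ β : RingOfIntegers K,
          IsUnit (Ideal.Quotient.mk (Ideal.span {(f : RingOfIntegers K)}) β) ∧
          Λ = latOf K f β)
    ∧ (∀ β β' : RingOfIntegers K,
        IsUnit (Ideal.Quotient.mk (Ideal.span {(f : RingOfIntegers K)}) β) →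
        IsUnit (Ideal.Quotient.mk (Ideal.span {(f : RingOfIntegers K)}) β') →
        (latOf K f β = latOf K f β' ↔
          ∃ n : ℤ, Int.gcd n f = 1 ∧
            Ideal.Quotient.mk (Ideal.span {(f : RingOfIntegers K)}) β'
              = Ideal.Quotient.mk (Ideal.span {(f : RingOfIntegers K)})
                  ((n : RingOfIntegers K) * β)))
    ∧ (∃ ψ : ((RingOfIntegers K ⧸ Ideal.span {(f : RingOfIntegers K)})ˣ ⧸ intSubgrp K f)
          → AddSubgroup (RingOfIntegers K),
        Function.Injective ψ ∧
        Set.range ψ = {Λ | IsPrimevalOf K f Λ} ∧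
        ∀ (β : RingOfIntegers K)
          (hβ : IsUnit (Ideal.Quotient.mk (Ideal.span {(f : RingOfIntegers K)}) β)),
          ψ (QuotientGroup.mk hβ.unit) = latOf K f β) := by
  refine ⟨fun β hβ ↦ isPrimevalOf_latOf hdeg hf hβ,
    fun Λ hΛ ↦ hΛ.exists_eq_latOf hdeg hf, fun β β' hβ hβ' ↦ latOf_eq_latOf_iff hβ hβ', ?_⟩
  let L (u : (𝓞 K ⧸ Ideal.span {(f : 𝓞 K)})ˣ) : AddSubgroup (𝓞 K) :=
    (AddSubgroup.zmultiples (u : 𝓞 K ⧸ Ideal.span {(f : 𝓞 K)})).comap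
      (Ideal.Quotient.mk (Ideal.span {(f : 𝓞 K)})).toAddMonoidHom
  have hL (u v : (𝓞 K ⧸ Ideal.span {(f : 𝓞 K)})ˣ) : L u = L v ↔ u⁻¹ * v ∈ intSubgrp K f := by
    rw [(AddSubgroup.comap_injective Ideal.Quotient.mk_surjective).eq_iff,
      zmultiples_unit_eq_iff, mem_intSubgrp_iff]
    simp_rw [Units.val_mul, Units.inv_mul_eq_iff_eq_mul, mul_comm u.val]
  have hψ (β : 𝓞 K) (hβ : IsUnit (Ideal.Quotient.mk (Ideal.span {(f : 𝓞 K)}) β)) :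
      L hβ.unit = latOf K f β := (latOf_eq_comap β).symm
  refine ⟨Quotient.lift L fun u v h ↦ (hL u v).mpr (QuotientGroup.leftRel_apply.mp h), ?_, ?_, hψ⟩
  · rintro ⟨u⟩ ⟨v⟩ h
    exact QuotientGroup.eq.mpr ((hL u v).mp h)
  · ext Λ
    constructor
    · rintro ⟨⟨u⟩, rfl⟩
      obtain ⟨β, hβ⟩ := Ideal.Quotient.mk_surjective (u : 𝓞 K ⧸ Ideal.span {(f : 𝓞 K)})
      have hu : IsUnit (Ideal.Quotient.mk (Ideal.span {(f : 𝓞 K)}) β) := hβ ▸ u.isUnit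
      obtain rfl : hu.unit = u := Units.ext hβ
      change IsPrimevalOf K f (L hu.unit)
      exact hψ β hu ▸ isPrimevalOf_latOf hdeg hf hu
    · intro hΛ
      obtain ⟨β, hβ, rfl⟩ := hΛ.exists_eq_latOf hdeg hf
      exact ⟨QuotientGroup.mk hβ.unit, hψ β hβ⟩
end

section
/- Suppose Δ < −11. Define c ∈ ℂ by c = 1/2 + √Δ/4 if Δ ≡ 0 (mod 4) and c = 1/2 + (−Δ−1)/(4√Δ) if Δ ≡ 1 (mod 4). Then |c|² > 1, so that G := {z ∈ ℂ : |z − c|² = |c|² − 1} is a circle orthogonal to the unit circle (the ghost circle of K); its curvature satisfies 1/√(|c|² − 1) = 4/√(−Δ−12) if Δ ≡ 0 (mod 4) and 1/√(|c|² − 1) = 4√(−Δ)/√(Δ² + 14Δ + 1) if Δ ≡ 1 (mod 4); and no K-Bianchi circle intersects G: for every M ∈ SL₂(O_K) and every z ∈ M(ℝ̂) ∩ ℂ, one has |z − c|² ≠ |c|² − 1. -/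
open Complex ComplexConjugate NumberField

theorem exists_basis_one_of_finrank_two {K : Type*} [Field K] [NumberField K]
    (hdeg : Module.finrank ℚ K = 2) :
    ∃ b : Module.Basis (Fin 2) ℤ (𝓞 K), b 0 = 1 := by
  have hrank : Module.finrank ℤ (𝓞 K) = 2 := by rw [RingOfIntegers.rank, hdeg]
  let b := Module.finBasisOfFinrankEq ℤ (𝓞 K) hrank
  set p := b.repr 1 0 with hp
  set q := b.repr 1 1 with hq
  have h1 : (1 : 𝓞 K) = p • b 0 + q • b 1 := by
    conv_lhs => rw [← b.sum_repr 1]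
    simp [Fin.sum_univ_two, hp, hq]
  have hpq : IsCoprime p q := by
    rw [Int.isCoprime_iff_gcd_eq_one]
    obtain ⟨p', hp'⟩ := Int.gcd_dvd_left p q
    obtain ⟨q', hq'⟩ := Int.gcd_dvd_right p q
    have h2 : algebraMap ℤ (𝓞 K) (Int.gcd p q) * (p' • b 0 + q' • b 1) = 1 := by
      rw [← Algebra.smul_def, smul_add, smul_smul, smul_smul, ← hp', ← hq']
      exact h1.symm
    have h3 := congrArg (Algebra.norm ℤ) h2
    rw [map_mul, map_one (Algebra.norm ℤ), Algebra.norm_algebraMap_of_basis b, Fintype.card_fin] at h3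
    have h4 : IsUnit ((Int.gcd p q : ℤ)) :=
      isUnit_of_dvd_one ((dvd_pow_self _ two_ne_zero).trans (Dvd.intro _ h3))
    simpa [Int.isUnit_iff_natAbs_eq] using h4
  obtain ⟨r, s, hrs⟩ := hpq
  have hli : LinearIndependent ℤ ![(1 : 𝓞 K), (-s) • b 0 + r • b 1] := by
    rw [LinearIndependent.pair_iff]
    intro u v huv
    have huv' := congrArg b.repr huv
    have e0 := DFunLike.congr_fun huv' 0
    have e1 := DFunLike.congr_fun huv' 1
    simp [-zsmul_eq_mul, -zsmul_one, ← hp, ← hq] at e0 e1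
    constructor
    · linear_combination r * e0 + s * e1 - u * hrs
    · linear_combination p * e1 - q * e0 - v * hrs
  have hspan : ⊤ ≤ Submodule.span ℤ (Set.range ![(1 : 𝓞 K), (-s) • b 0 + r • b 1]) := by
    rw [← b.span_eq, Submodule.span_le]
    rintro _ ⟨i, rfl⟩
    rw [SetLike.mem_coe, Matrix.range_cons, Matrix.range_cons, Matrix.range_empty,
      Set.union_empty, Set.singleton_union, Submodule.mem_span_pair]
    fin_cases i
    · refine ⟨r, -q, ?_⟩
      rw [h1]
      have : (r * p + s * q) • b 0 = b 0 := by rw [hrs, one_smul]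
      simp only [Fin.zero_eta]
      linear_combination this
    · refine ⟨s, p, ?_⟩
      rw [h1]
      have : (r * p + s * q) • b 1 = b 1 := by rw [hrs, one_smul]
      simp only [Fin.mk_one]
      linear_combination this
  exact ⟨Module.Basis.mk hli hspan, by simp⟩

theorem exists_generator_of_finrank_two {K : Type*} [Field K] [NumberField K]
    (hdeg : Module.finrank ℚ K = 2) :
    ∃ (ω : 𝓞 K) (t n : ℤ), ω ^ 2 = t * ω - n ∧ discr K = t ^ 2 - 4 * n ∧
      (∀ x : 𝓞 K, ∃ a b : ℤ, x = a + b * ω) ∧ ∀ a b : ℤ, (a : 𝓞 K) + b * ω = 0 → b = 0 := by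
  obtain ⟨b, hb⟩ := exists_basis_one_of_finrank_two hdeg
  have hrepr (x : 𝓞 K) : x = (b.repr x 0 : 𝓞 K) + (b.repr x 1 : 𝓞 K) * b 1 := by
    conv_lhs => rw [← b.sum_repr x]
    simp [Fin.sum_univ_two, hb]
  have hsq : b 1 ^ 2 = (b.repr (b 1 ^ 2) 1 : 𝓞 K) * b 1 - ((-b.repr (b 1 ^ 2) 0 : ℤ) : 𝓞 K) := by
    push_cast
    linear_combination hrepr (b 1 ^ 2)
  have htr1 : Algebra.trace ℤ (𝓞 K) 1 = 2 := by
    have := Algebra.trace_algebraMap_of_basis b 1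
    simpa using this
  have htr : Algebra.trace ℤ (𝓞 K) (b 1) = b.repr (b 1 ^ 2) 1 := by
    rw [Algebra.trace_eq_matrix_trace b, Matrix.trace_fin_two]
    simp [Algebra.leftMulMatrix_apply, LinearMap.toMatrix_apply, hb, ← sq]
  refine ⟨b 1, b.repr (b 1 ^ 2) 1, -b.repr (b 1 ^ 2) 0, hsq, ?_,
    fun x ↦ ⟨_, _, hrepr x⟩, fun u v huv ↦ ?_⟩
  · have htr2 : Algebra.trace ℤ (𝓞 K) (b 1 * b 1) =
        b.repr (b 1 ^ 2) 1 * b.repr (b 1 ^ 2) 1 + b.repr (b 1 ^ 2) 0 * 2 := by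
      have h : b 1 * b 1 = b.repr (b 1 ^ 2) 1 • b 1 + b.repr (b 1 ^ 2) 0 • (1 : 𝓞 K) := by
        rw [zsmul_eq_mul, zsmul_eq_mul]
        linear_combination hrepr (b 1 ^ 2)
      rw [h, map_add, map_smul, map_smul, htr, htr1, smul_eq_mul, smul_eq_mul]
    rw [← discr_eq_discr K b, Algebra.discr_def, Matrix.det_fin_two]
    simp only [Algebra.traceMatrix_apply, Algebra.traceForm_apply, hb, one_mul, mul_one, htr1,
      htr2, htr]
    ring
  · have h : u • b 0 + v • b 1 = 0 := by simpa [hb] using huv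
    have := DFunLike.congr_fun (congrArg b.repr h) 1
    simpa [-zsmul_eq_mul] using this

theorem discr_ne_neg_twelve {K : Type*} [Field K] [NumberField K]
    (hdeg : Module.finrank ℚ K = 2) : discr K ≠ -12 := by
  intro hd
  obtain ⟨ω, t, n, hω, hdisc, hgen, hind⟩ := exists_generator_of_finrank_two hdeg
  rw [hd] at hdisc
  obtain ⟨k, rfl⟩ : Even t := by
    by_contra h
    rw [Int.not_even_iff_odd] at h
    obtain ⟨m, rfl⟩ := h
    ring_nf at hdisc
    omega
  have hn : n = k ^ 2 + 3 := by linarith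
  let θ : K := (1 + ((ω : K) - k)) / 2
  have hωK : (ω : K) ^ 2 = (k + k) * ω - (k ^ 2 + 3) := by
    have := congrArg (algebraMap (𝓞 K) K) hω
    rw [hn] at this
    simpa [map_ofNat (algebraMap (𝓞 K) K) 3] using this
  have hθ : θ ^ 2 - θ + 1 = 0 := by
    simp only [θ]
    linear_combination hωK / 4
  have hint : IsIntegral ℤ θ := by
    refine ⟨Polynomial.X ^ 2 - Polynomial.X + 1, by monicity!, ?_⟩
    simpa using hθ
  obtain ⟨x, hx⟩ : ∃ x : 𝓞 K, (x : K) = θ := ⟨⟨θ, hint⟩, rfl⟩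
  obtain ⟨u, v, rfl⟩ := hgen x
  have h : ((2 * u - 1 + k : ℤ) : 𝓞 K) + ((2 * v - 1 : ℤ) : 𝓞 K) * ω = 0 := by
    apply RingOfIntegers.coe_injective
    simp [θ, map_ofNat (algebraMap (𝓞 K) K) 2] at hx ⊢
    linear_combination 2 * hx
  have := hind _ _ h
  omega

/-- Every integer of `K` embeds as `(a + b √Δ) / 2` with `a ≡ b Δ` modulo `2`. -/
theorem exists_coords {K : Type} [Field K] [NumberField K]
    (hdeg : Module.finrank ℚ K = 2) (hneg : discr K < 0) (ι : K →+* ℂ) (x : 𝓞 K) :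
    ∃ a b : ℤ, ι (algebraMap (𝓞 K) K x) = (a + b * (I * (√(-(discr K : ℝ)) : ℝ))) / 2 ∧
      2 ∣ a - b * discr K := by
  obtain ⟨ω, t, n, hω, hdisc, hgen, -⟩ := exists_generator_of_finrank_two hdeg
  obtain ⟨u, v, rfl⟩ := hgen x
  have hsq : ((√(-(discr K : ℝ)) : ℝ) : ℂ) ^ 2 = -(discr K : ℂ) := by
    rw [← ofReal_pow, Real.sq_sqrt (by exact_mod_cast (neg_pos.2 hneg).le)]
    simp
  set z : ℂ := ι (algebraMap (𝓞 K) K ω) with hz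
  have hz2 : z ^ 2 = t * z - n := by
    have := congrArg (fun y ↦ ι (algebraMap (𝓞 K) K y)) hω
    simpa using this
  have hdC : (discr K : ℂ) = t ^ 2 - 4 * n := by exact_mod_cast congrArg (Int.cast : ℤ → ℂ) hdisc
  have hfac : (2 * z - t) ^ 2 = (I * (√(-(discr K : ℝ)) : ℝ)) ^ 2 := by
    rw [mul_pow, I_sq, hsq]
    linear_combination 4 * hz2 - hdC
  have hpar (w : ℤ) : 2 ∣ w * t - w * discr K := by
    rw [hdisc, show w * t - w * (t ^ 2 - 4 * n) = w * (4 * n) - w * (t * (t - 1)) by ring]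
    exact dvd_sub (Dvd.dvd.mul_left (by omega) _)
      (Dvd.dvd.mul_left (Int.even_mul_pred_self t).two_dvd _)
  rcases sq_eq_sq_iff_eq_or_eq_neg.1 hfac with h | h
  · refine ⟨2 * u + v * t, v, ?_, ?_⟩
    · simp [← hz]
      linear_combination v / 2 * h
    · have := hpar v
      omega
  · refine ⟨2 * u + v * t, -v, ?_, ?_⟩
    · simp [← hz]
      linear_combination v / 2 * h
    · have := hpar (-v)
      have := dvd_mul_right 2 (v * t)
      rw [show 2 * u + v * t - -v * discr K = 2 * u + 2 * (v * t) + (-v * t - -v * discr K) by ring]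
      omega

theorem im_eq_zero_of_mem_mobiusFin {α β γ δ z : ℂ} (hdet : α * δ - γ * β = 1)
    (hz : z ∈ mobiusFin α β γ δ) : ((δ * z - γ) * conj (α - β * z)).im = 0 := by
  rcases hz with ⟨x, hx, rfl⟩ | ⟨hβ, rfl⟩
  · have h1 : δ * ((α * x + γ) / (β * x + δ)) - γ = x / (β * x + δ) := by
      rw [eq_div_iff hx, sub_mul, mul_assoc, div_mul_cancel₀ _ hx]
      linear_combination (x : ℂ) * hdet
    have h2 : α - β * ((α * x + γ) / (β * x + δ)) = 1 / (β * x + δ) := by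
      field_simp
      linear_combination hdet
    rw [h1, h2, map_div₀, map_one, div_mul_div_comm, mul_conj, mul_one, ← ofReal_div, ofReal_im]
  · simp [mul_div_cancel₀ _ hβ]

/-- Two circles through a common point have a normalized product of absolute value at most `1`. -/
theorem sq_im_mul_sub_le_of_mem_mobiusFin {α β γ δ z c : ℂ} (hdet : α * δ - γ * β = 1)
    (hz : z ∈ mobiusFin α β γ δ) (hzc : normSq (z - c) = normSq c - 1) :
    (((δ * conj α - conj γ * β) * c).im - ((δ * conj β).im + (γ * conj α).im)) ^ 2 ≤
      normSq c - 1 := by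
  have hz0 := im_eq_zero_of_mem_mobiusFin hdet hz
  set w := δ * conj α - conj γ * β with hw
  set A := (δ * conj β).im with hA
  set B := (γ * conj α).im with hB
  have hnorm : normSq w - 4 * (A * B) = 1 := by
    have h : normSq w - 4 * (A * B) = normSq (α * δ - γ * β) := by
      simp only [hw, hA, hB, normSq_apply, mul_re, mul_im, sub_re, sub_im, conj_re, conj_im]
      ring
    rw [h, hdet, map_one]
  have hcirc : A * normSq z - (w * z).im + B = 0 := by
    rw [← neg_eq_zero, ← hz0]
    simp only [hw, hA, hB, normSq_apply, mul_re, mul_im, sub_re, sub_im, conj_re, conj_im]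
    ring
  clear_value w A B
  simp only [normSq_apply, mul_im, sub_re, sub_im] at hzc hnorm hcirc ⊢
  have hinner : w.re * c.im + w.im * c.re - (A + B) =
      2 * ((w.im / 2 - A * z.re) * (c.re - z.re) + (w.re / 2 - A * z.im) * (c.im - z.im)) := by
    linear_combination -A * hzc - hcirc
  have hP : (w.im / 2 - A * z.re) ^ 2 + (w.re / 2 - A * z.im) ^ 2 = 1 / 4 := by
    linear_combination hnorm / 4 + A * hcirc
  rw [hinner]
  nlinarith [sq_nonneg ((w.im / 2 - A * z.re) * (c.im - z.im) -
    (w.re / 2 - A * z.im) * (c.re - z.re))]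

theorem exists_sq_le_of_mem_mobiusFin {K : Type} [Field K] [NumberField K]
    (hdeg : Module.finrank ℚ K = 2) (hneg : discr K < 0) (ι : K →+* ℂ)
    (M : Matrix.SpecialLinearGroup (Fin 2) (𝓞 K)) {z c : ℂ}
    (hz : z ∈ mobiusFin (emb K ι (M.1 0 0)) (emb K ι (M.1 1 0))
      (emb K ι (M.1 0 1)) (emb K ι (M.1 1 1)))
    (hc : c.re = 1 / 2) (hzc : normSq (z - c) = normSq c - 1) :
    ∃ f j : ℤ, ((1 + discr K * f / 2) * c.im +
      √(-(discr K : ℝ)) * (discr K * f + 2 * j) / 4) ^ 2 ≤ normSq c - 1 := by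
  have hdet :
      emb K ι (M.1 0 0) * emb K ι (M.1 1 1) - emb K ι (M.1 0 1) * emb K ι (M.1 1 0) = 1 := by
    have h := M.2
    rw [Matrix.det_fin_two] at h
    have h' := congrArg (emb K ι) h
    simpa [emb] using h'
  have hle := sq_im_mul_sub_le_of_mem_mobiusFin hdet hz hzc
  obtain ⟨a₁, a₂, hα, k₁, hk₁⟩ := exists_coords hdeg hneg ι (M.1 0 0)
  obtain ⟨b₁, b₂, hβ, k₂, hk₂⟩ := exists_coords hdeg hneg ι (M.1 1 0)
  obtain ⟨c₁, c₂, hγ, k₃, hk₃⟩ := exists_coords hdeg hneg ι (M.1 0 1)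
  obtain ⟨d₁, d₂, hδ, k₄, hk₄⟩ := exists_coords hdeg hneg ι (M.1 1 1)
  have hsq : √(-(discr K : ℝ)) ^ 2 = -discr K :=
    Real.sq_sqrt (by exact_mod_cast (neg_pos.2 hneg).le)
  change emb K ι _ = _ at hα hβ hγ hδ
  generalize emb K ι (M.1 0 0) = α at *
  generalize emb K ι (M.1 1 0) = β at *
  generalize emb K ι (M.1 0 1) = γ at *
  generalize emb K ι (M.1 1 1) = δ at *
  generalize √(-(discr K : ℝ)) = τ at *
  generalize discr K = D at *
  have hcoord {x : ℂ} {p q : ℤ} (hx : x = (p + q * (I * (τ : ℝ))) / 2) :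
      x.re = p / 2 ∧ x.im = q * τ / 2 := by
    rw [hx]
    constructor <;> simp
  obtain ⟨hαr, hαi⟩ := hcoord hα
  obtain ⟨hβr, hβi⟩ := hcoord hβ
  obtain ⟨hγr, hγi⟩ := hcoord hγ
  obtain ⟨hδr, hδi⟩ := hcoord hδ
  have hdet_re := congrArg re hdet
  have hdet_im := congrArg im hdet
  refine ⟨c₂ * b₂ - a₂ * d₂,
    c₂ * k₂ - a₂ * k₄ - (d₂ * k₂ - k₄ * b₂ + c₂ * k₁ - k₃ * a₂), ?_⟩
  convert hle using 2
  have ha : (a₁ : ℝ) = a₂ * D + 2 * k₁ := by exact_mod_cast (by linarith : a₁ = a₂ * D + 2 * k₁)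
  have hb : (b₁ : ℝ) = b₂ * D + 2 * k₂ := by exact_mod_cast (by linarith : b₁ = b₂ * D + 2 * k₂)
  have hcc : (c₁ : ℝ) = c₂ * D + 2 * k₃ := by exact_mod_cast (by linarith : c₁ = c₂ * D + 2 * k₃)
  have hd : (d₁ : ℝ) = d₂ * D + 2 * k₄ := by exact_mod_cast (by linarith : d₁ = d₂ * D + 2 * k₄)
  simp only [mul_re, mul_im, sub_re, sub_im, conj_re, conj_im, one_re, one_im, hαr, hαi, hβr, hβi,
    hγr, hγi, hδr, hδi, hc] at hdet_re hdet_im ⊢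
  push_cast
  rw [ha, hb, hcc, hd] at *
  linear_combination (-c.im) * hdet_re - (1 / 2) * hdet_im +
    ((c₂ * b₂ - a₂ * d₂ : ℝ) * c.im / 2) * hsq

theorem discr_emod_four_of_finrank_two {K : Type*} [Field K] [NumberField K]
    (hdeg : Module.finrank ℚ K = 2) : discr K % 4 = 0 ∨ discr K % 4 = 1 := by
  obtain ⟨-, t, n, -, hdisc, -⟩ := exists_generator_of_finrank_two hdeg
  rw [hdisc]
  obtain ⟨m, rfl⟩ | ⟨m, rfl⟩ := Int.even_or_odd t
  · left
    ring_nf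
    omega
  · right
    ring_nf
    omega

/-- The lower bound for the product of a Bianchi circle and the ghost circle, even discriminant. -/
theorem sq_div_sixteen_le_of_emod_four_eq_zero {D : ℤ} (hD : D % 4 = 0) (τ : ℝ) (f j : ℤ) :
    τ ^ 2 / 16 ≤ ((1 + D * f / 2) * (τ / 4) + τ * (D * f + 2 * j) / 4) ^ 2 := by
  obtain ⟨m, rfl⟩ := Int.dvd_of_emod_eq_zero hD
  have hodd : (1 : ℝ) ≤ ((1 + 2 * (3 * m * f + j) : ℤ) : ℝ) ^ 2 := by
    have h : (1 + 2 * (3 * m * f + j)) ≠ 0 := by omega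
    exact_mod_cast Int.one_le_abs (pow_ne_zero 2 h) |>.trans_eq (abs_of_nonneg (sq_nonneg _))
  have h := mul_le_mul_of_nonneg_left hodd (by positivity : 0 ≤ τ ^ 2 / 16)
  push_cast at h ⊢
  linarith

/-- The lower bound for the product of a Bianchi circle and the ghost circle, odd discriminant. -/
theorem sq_le_of_emod_four_eq_one {D : ℤ} (hD : D % 4 = 1) (hneg : D < 0) {τ : ℝ} (hτ : 0 < τ)
    (hτD : τ ^ 2 = -D) (f j : ℤ) :
    ((D + 1) / (4 * τ)) ^ 2 ≤
      ((1 + D * f / 2) * ((D + 1) / (4 * τ)) + τ * (D * f + 2 * j) / 4) ^ 2 := by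
  obtain ⟨m, hm⟩ : ∃ m, D = 4 * m + 1 := ⟨D / 4, by omega⟩
  have key : (1 + D * f / 2) * ((D + 1) / (4 * τ)) + τ * (D * f + 2 * j) / 4 =
      (((D + 1) - 2 * D * (m * f + j) : ℤ) : ℝ) / (4 * τ) := by
    have hmR : (D : ℝ) = 4 * m + 1 := by exact_mod_cast hm
    field_simp
    rw [hτD]
    push_cast
    linear_combination (-(D : ℝ) * f) * hmR
  rw [key, div_pow, div_pow]
  refine div_le_div_of_nonneg_right ?_ (by positivity)
  rw [sq_le_sq]
  have : |D + 1| ≤ |D + 1 - 2 * D * (m * f + j)| := by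
    rcases le_or_gt (m * f + j) 0 with h | h
    · rcases h.eq_or_lt with h | h
      · simp [h]
      · rw [abs_of_nonpos (by omega)]
        refine le_trans ?_ (neg_le_abs _)
        nlinarith
    · rw [abs_of_nonpos (by omega)]
      refine le_trans ?_ (le_abs_self _)
      nlinarith
  exact_mod_cast this

/-- Suppose `Δ < −11` and let `c = 1/2 + √Δ/4` (`Δ ≡ 0 mod 4`) or
`c = 1/2 + (−Δ−1)/(4√Δ)` (`Δ ≡ 1 mod 4`), where `√Δ = i√(−Δ)`. Then `|c|² > 1`, so that
`G = {z : |z−c|² = |c|²−1}` is a circle orthogonal to the unit circle (the ghost circle);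
its curvature `1/√(|c|²−1)` equals `4/√(−Δ−12)` resp. `4√(−Δ)/√(Δ²+14Δ+1)`; and no
`K`-Bianchi circle meets `G`. -/
theorem stmt15 (K : Type) [Field K] [NumberField K]
    (hdeg : Module.finrank ℚ K = 2) (hdisc : NumberField.discr K < -11)
    (ι : K →+* ℂ)
    (c : ℂ)
    (hc : c = if NumberField.discr K % 4 = 0
        then 1 / 2 + Complex.I * (Real.sqrt (-(NumberField.discr K : ℝ)) : ℂ) / 4
        else 1 / 2 + (-(NumberField.discr K : ℂ) - 1)
          / (4 * (Complex.I * (Real.sqrt (-(NumberField.discr K : ℝ)) : ℂ)))) :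
    1 < Complex.normSq c
    ∧ (NumberField.discr K % 4 = 0 →
        1 / Real.sqrt (Complex.normSq c - 1)
          = 4 / Real.sqrt (-(NumberField.discr K : ℝ) - 12))
    ∧ (NumberField.discr K % 4 ≠ 0 →
        1 / Real.sqrt (Complex.normSq c - 1)
          = 4 * Real.sqrt (-(NumberField.discr K : ℝ))
            / Real.sqrt ((NumberField.discr K : ℝ) ^ 2 + 14 * (NumberField.discr K : ℝ) + 1))
    ∧ (∀ M : Matrix.SpecialLinearGroup (Fin 2) (RingOfIntegers K),
        ∀ z ∈ mobiusFin (emb K ι (M.1 0 0)) (emb K ι (M.1 1 0))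
                (emb K ι (M.1 0 1)) (emb K ι (M.1 1 1)),
          Complex.normSq (z - c) ≠ Complex.normSq c - 1) := by
  have hneg : discr K < 0 := by omega
  have hnegR : (0 : ℝ) < -(discr K : ℝ) := by exact_mod_cast neg_pos.2 hneg
  have hτ : 0 < √(-(discr K : ℝ)) := Real.sqrt_pos.2 hnegR
  have hτsq : √(-(discr K : ℝ)) ^ 2 = -(discr K : ℝ) := Real.sq_sqrt hnegR.le
  have hmeet (M : Matrix.SpecialLinearGroup (Fin 2) (𝓞 K)) (z : ℂ) :=
    exists_sq_le_of_mem_mobiusFin hdeg hneg ι M (z := z) (c := c)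
  rcases discr_emod_four_of_finrank_two hdeg with hmod | hmod
  · have hlt : discr K < -12 := lt_of_le_of_ne (by omega) (discr_ne_neg_twelve hdeg)
    have hltR : (discr K : ℝ) < -12 := by exact_mod_cast hlt
    rw [if_pos hmod] at hc
    have hre : c.re = 1 / 2 := by simp [hc]
    have him : c.im = √(-(discr K : ℝ)) / 4 := by simp [hc]
    have hnorm : normSq c - 1 = (-(discr K : ℝ) - 12) / 4 ^ 2 := by
      rw [normSq_apply, hre, him]
      linear_combination hτsq / 16
    refine ⟨by linarith, fun _ ↦ ?_, fun h ↦ absurd hmod h, fun M z hz hzc ↦ ?_⟩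
    · rw [hnorm, Real.sqrt_div' _ (by positivity), Real.sqrt_sq (by norm_num), one_div_div]
    · obtain ⟨f, j, h⟩ := hmeet M z hz hre hzc
      rw [him] at h
      have := sq_div_sixteen_le_of_emod_four_eq_zero hmod √(-(discr K : ℝ)) f j
      linarith
  · have hle : (discr K : ℝ) ≤ -15 := by exact_mod_cast (by omega : discr K ≤ -15)
    rw [if_neg (by omega)] at hc
    have hc' : c = ((1 / 2 : ℝ) : ℂ) +
        (((discr K : ℝ) + 1) / (4 * √(-(discr K : ℝ))) : ℝ) * I := by
      have : ((√(-(discr K : ℝ)) : ℝ) : ℂ) ≠ 0 := by exact_mod_cast hτ.ne'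
      rw [hc]
      push_cast
      field_simp
      linear_combination (-2 * ((discr K : ℂ) + 1)) * I_sq
    have hre : c.re = 1 / 2 := by
      simp only [hc', add_re, ofReal_re, re_ofReal_mul, I_re, mul_zero, add_zero]
    have him : c.im = ((discr K : ℝ) + 1) / (4 * √(-(discr K : ℝ))) := by
      simp only [hc', add_im, ofReal_im, im_ofReal_mul, I_im, mul_one, zero_add]
    have hnorm : normSq c - 1 = ((discr K : ℝ) ^ 2 + 14 * discr K + 1) /
        (4 * √(-(discr K : ℝ))) ^ 2 := by
      rw [normSq_apply, hre, him]
      field_simp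
      linear_combination (-48) * hτsq
    have hpos : 0 < (discr K : ℝ) ^ 2 + 14 * discr K + 1 := by nlinarith
    refine ⟨?_, fun h ↦ by omega, fun _ ↦ ?_, fun M z hz hzc ↦ ?_⟩
    · rw [← sub_pos, hnorm]
      positivity
    · rw [hnorm, Real.sqrt_div' _ (by positivity), Real.sqrt_sq (by positivity), one_div_div]
    · obtain ⟨f, j, h⟩ := hmeet M z hz hre hzc
      have hlow := sq_le_of_emod_four_eq_one hmod hneg hτ hτsq f j
      rw [← him] at hlow
      have := hlow.trans h
      rw [normSq_apply, hre] at this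
      linarith
end
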